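/- Under Assumption 1, for any t ∈ ℝ at which the variation condition of Assumption 2 holds for the U-quantile kernel h, one has Σ_{1≤i<j≤n} h₂(X_i,X_j,t) = O(n^{5/4} log²n) almost surely; that is, almost surely limsup_{n→∞} |Σ_{1≤i<j≤n} h₂(X_i,X_j,t)| / (n^{5/4} log²n) < ∞. -/

import Mathlib

open MeasureTheory Filter Set
open scoped ENNReal NNReal Topology BigOperators

noncomputable section

namespace UQuantile

variable {Ω : Type*} [MeasurableSpace Ω]

/-- Strict stationarity of the pair process `((X_i, Z_i))_{i ∈ ℤ}`. -/
def IsPairStationary (P : Measure Ω) (X Z : ℤ → Ω → ℝ) : Prop :=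
  ∀ (k : ℤ) (n : ℕ) (idx : Fin n → ℤ),
    P.map (fun ω i => (X (idx i) ω, Z (idx i) ω)) =
      P.map (fun ω i => (X (idx i + k) ω, Z (idx i + k) ω))

/-- Near epoch dependence in probability (PNED) of `X` on `Z` with approximation
constants `a` and gauge function `φ`. -/
def PNED (P : Measure Ω) (X Z : ℤ → Ω → ℝ) (a : ℕ → ℝ) (φ : ℝ → ℝ) : Prop :=
  ∃ f : (l : ℕ) → ((Fin (2 * l + 1) → ℝ) → ℝ),
    (∀ l, Measurable (f l)) ∧
      ∀ (l : ℕ), ∀ ε > (0 : ℝ),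
        (P {ω | ε < |X 0 ω - f l fun i => Z (((i : ℕ) : ℤ) - (l : ℤ)) ω|}).toReal ≤ a l * φ ε

/-- The σ-field generated by `..., Z_{-1}, Z_0`. -/
def pastSigma (Z : ℤ → Ω → ℝ) : MeasurableSpace Ω :=
  ⨆ i : {i : ℤ // i ≤ 0}, MeasurableSpace.comap (Z i) Real.measurableSpace

/-- The σ-field generated by `Z_k, Z_{k+1}, ...`. -/
def futureSigma (Z : ℤ → Ω → ℝ) (k : ℕ) : MeasurableSpace Ω :=
  ⨆ i : {i : ℤ // (k : ℤ) ≤ i}, MeasurableSpace.comap (Z i) Real.measurableSpace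

/-- The σ-field generated by `Z_{-l}, ..., Z_l`. -/
def rangeSigma (Z : ℤ → Ω → ℝ) (l : ℕ) : MeasurableSpace Ω :=
  ⨆ i : {i : ℤ // -(l : ℤ) ≤ i ∧ i ≤ l}, MeasurableSpace.comap (Z i) Real.measurableSpace

/-- `β` bounds the absolute regularity coefficients of `Z`: for every `k` and every pair of
finite measurable partitions of `Ω` into past, resp. future measurable sets,
`(1/2) Σ_{i,j} |P(A_i ∩ B_j) - P(A_i) P(B_j)| ≤ β k`. -/
def IsBetaBound (P : Measure Ω) (Z : ℤ → Ω → ℝ) (β : ℕ → ℝ) : Prop :=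
  ∀ (k m m' : ℕ) (A : Fin m → Set Ω) (B : Fin m' → Set Ω),
    (∀ i, MeasurableSet[pastSigma Z] (A i)) →
    (∀ j, MeasurableSet[futureSigma Z k] (B j)) →
    Pairwise (Function.onFun Disjoint A) → Pairwise (Function.onFun Disjoint B) →
    (⋃ i, A i) = univ → (⋃ j, B j) = univ →
    (1 / 2 : ℝ) * ∑ i, ∑ j,
        |(P (A i ∩ B j)).toReal - (P (A i)).toReal * (P (B j)).toReal| ≤ β k

/-- Assumption 1: `((X_i, Z_i))` is strictly stationary, `X` is PNED on `Z` with
`a_l φ(l^{-6}) = O(l^{-6})`, and `Z` is absolutely regular with `Σ k β_k < ∞`. -/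
structure Assumption1 (P : Measure Ω) (X Z : ℤ → Ω → ℝ) : Prop where
  stationary : IsPairStationary P X Z
  pned : ∃ (a : ℕ → ℝ) (φ : ℝ → ℝ),
    Tendsto a atTop (𝓝 0) ∧ AntitoneOn φ (Ioi 0) ∧ (∀ x > (0 : ℝ), 0 < φ x) ∧
      PNED P X Z a φ ∧
      (fun l : ℕ => a l * φ ((l : ℝ) ^ (-6 : ℤ))) =O[atTop] fun l : ℕ => (l : ℝ) ^ (-6 : ℤ)
  mixing : ∃ β : ℕ → ℝ, (∀ k, 0 ≤ β k) ∧ IsBetaBound P Z β ∧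
      Summable fun k : ℕ => (k : ℝ) * β k

/-- A U-quantile kernel function: nonnegative, bounded, measurable, symmetric in the first
two arguments and non-decreasing in the third. -/
structure IsUQKernel (h : ℝ → ℝ → ℝ → ℝ) : Prop where
  nonneg : ∀ x y t, 0 ≤ h x y t
  bounded : ∃ M, ∀ x y t, h x y t ≤ M
  measurable : Measurable fun q : ℝ × ℝ × ℝ => h q.1 q.2.1 q.2.2
  symm : ∀ x y t, h x y t = h y x t
  mono : ∀ x y, Monotone (h x y)

/-- The empirical U-distribution function `U_n(t)`. -/
def Ustat (X : ℤ → Ω → ℝ) (h : ℝ → ℝ → ℝ → ℝ) (n : ℕ) (t : ℝ) (ω : Ω) : ℝ :=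
  (2 / ((n : ℝ) * ((n : ℝ) - 1))) *
    ∑ i ∈ Finset.Icc (1 : ℤ) (n : ℤ), ∑ j ∈ Finset.Ioc i (n : ℤ), h (X i ω) (X j ω) t

/-- The population U-distribution function `U(t) = E h(X, Y, t)` for `X, Y` independent
with law `μ`. -/
def Udist (μ : Measure ℝ) (h : ℝ → ℝ → ℝ → ℝ) (t : ℝ) : ℝ := ∫ x, ∫ y, h x y t ∂μ ∂μ

/-- The linear part of the Hoeffding decomposition, `h₁(x, t) = E h(x, X₀, t) - U(t)`. -/
def h1 (μ : Measure ℝ) (h : ℝ → ℝ → ℝ → ℝ) (x t : ℝ) : ℝ := (∫ y, h x y t ∂μ) - Udist μ h t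

/-- The degenerate part of the Hoeffding decomposition. -/
def h2 (μ : Measure ℝ) (h : ℝ → ℝ → ℝ → ℝ) (x y t : ℝ) : ℝ :=
  h x y t - h1 μ h x t - h1 μ h y t - Udist μ h t

/-- The population `p`-U-quantile `U⁻¹(p)`. -/
def Uinv (μ : Measure ℝ) (h : ℝ → ℝ → ℝ → ℝ) (p : ℝ) : ℝ := sInf {t | p ≤ Udist μ h t}

/-- The empirical `p`-U-quantile `U_n⁻¹(p)`. -/
def UinvEmp (X : ℤ → Ω → ℝ) (h : ℝ → ℝ → ℝ → ℝ) (n : ℕ) (p : ℝ) (ω : Ω) : ℝ :=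
  sInf {t | p ≤ Ustat X h n t ω}

/-- The variation condition for `h(·,·,t)` with constant `L`, with respect to the law `μ`. -/
def VariationAt (μ : Measure ℝ) (h : ℝ → ℝ → ℝ → ℝ) (L t : ℝ) : Prop :=
  ∀ ε > (0 : ℝ),
    ∫⁻ q : ℝ × ℝ, ENNReal.ofReal
        ((⨆ r ∈ Metric.closedBall q ε, |h r.1 r.2 t - h q.1 q.2 t|) ^ 2) ∂(μ.prod μ)
      ≤ ENNReal.ofReal (L * ε)

/-- Assumption 2: the variation condition holds for all `t` in a neighborhood of `U⁻¹(p)`. -/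
def Assumption2 (μ : Measure ℝ) (h : ℝ → ℝ → ℝ → ℝ) (p : ℝ) : Prop :=
  ∃ L δ : ℝ, 0 < δ ∧ ∀ t, |t - Uinv μ h p| < δ → VariationAt μ h L t

/-- Assumption 3: `U` is differentiable near `U⁻¹(p)` with derivative `u`,
`u(U⁻¹(p)) > 0`, and a `3/2`-order Taylor-type expansion holds at `U⁻¹(p)`. -/
def Assumption3 (μ : Measure ℝ) (h : ℝ → ℝ → ℝ → ℝ) (p : ℝ) (u : ℝ → ℝ) : Prop :=
  (∀ᶠ t in 𝓝 (Uinv μ h p), HasDerivAt (Udist μ h) (u t) t) ∧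
    0 < u (Uinv μ h p) ∧
    (fun t => Udist μ h t - p - u (Uinv μ h p) * (t - Uinv μ h p)) =o[𝓝 (Uinv μ h p)]
      fun t => |t - Uinv μ h p| ^ ((3 : ℝ) / 2)

/-- The lag-`r` autocovariance `Cov(f(X_0), f(X_r))`. -/
def covShift (P : Measure Ω) (X : ℤ → Ω → ℝ) (f : ℝ → ℝ) (r : ℤ) : ℝ :=
  (∫ ω, f (X 0 ω) * f (X r ω) ∂P) - (∫ ω, f (X 0 ω) ∂P) * ∫ ω, f (X r ω) ∂P

/-- The long-run variance `σ_p²` of the `p`-U-quantile. -/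
def lrv (P : Measure Ω) (X : ℤ → Ω → ℝ) (h : ℝ → ℝ → ℝ → ℝ) (p : ℝ) (u : ℝ → ℝ) : ℝ :=
  (4 / u (Uinv (P.map (X 0)) h p) ^ 2) *
    ∑' r : ℤ, covShift P X (fun x => h1 (P.map (X 0)) h x (Uinv (P.map (X 0)) h p)) r

end UQuantile

namespace UQuantile

/-- The ring of finite unions of rectangles. -/
def rectRing (E₁ E₂ : Type*) [MeasurableSpace E₁] [MeasurableSpace E₂] : Set (Set (E₁ × E₂)) :=
  {S | ∃ (α β : Type) (_ : Fintype α) (_ : Fintype β) (a : E₁ → α) (b : E₂ → β),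
    (∀ x, MeasurableSet (a ⁻¹' {x})) ∧ (∀ x, MeasurableSet (b ⁻¹' {x})) ∧
    ∃ T : Set (α × β), S = (Prod.map a b) ⁻¹' T}

lemma fiber_pair {E : Type*} [MeasurableSpace E] {α β : Type} (a : E → α) (b : E → β)
    (ha : ∀ x, MeasurableSet (a ⁻¹' {x})) (hb : ∀ x, MeasurableSet (b ⁻¹' {x})) (x : α × β) :
    MeasurableSet ((fun e => (a e, b e)) ⁻¹' {x}) := by
  have : (fun e => (a e, b e)) ⁻¹' {x} = a ⁻¹' {x.1} ∩ b ⁻¹' {x.2} := by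
    ext e; simp [Prod.ext_iff]
  rw [this]; exact (ha _).inter (hb _)

lemma rectRing_isSetRing (E₁ E₂ : Type*) [MeasurableSpace E₁] [MeasurableSpace E₂] :
    IsSetRing (rectRing E₁ E₂) where
  empty_mem := ⟨Unit, Unit, inferInstance, inferInstance, fun _ => (), fun _ => (),
    by simp, by simp, ∅, by simp⟩
  union_mem := by
    rintro s t ⟨α, β, _, _, a, b, ha, hb, T, rfl⟩ ⟨α', β', _, _, a', b', ha', hb', T', rfl⟩
    refine ⟨α × α', β × β', inferInstance, inferInstance, fun e => (a e, a' e),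
      fun e => (b e, b' e), fiber_pair a a' ha ha', fiber_pair b b' hb hb',
      {x | (x.1.1, x.2.1) ∈ T ∨ (x.1.2, x.2.2) ∈ T'}, ?_⟩
    ext ⟨x, y⟩; simp
  sdiff_mem := by
    rintro s t ⟨α, β, _, _, a, b, ha, hb, T, rfl⟩ ⟨α', β', _, _, a', b', ha', hb', T', rfl⟩
    refine ⟨α × α', β × β', inferInstance, inferInstance, fun e => (a e, a' e),
      fun e => (b e, b' e), fiber_pair a a' ha ha', fiber_pair b b' hb hb',
      {x | (x.1.1, x.2.1) ∈ T ∧ ¬ (x.1.2, x.2.2) ∈ T'}, ?_⟩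
    ext ⟨x, y⟩; simp

lemma rectRing_eq_biUnion {E₁ E₂ : Type*} {α β : Type}
    (a : E₁ → α) (b : E₂ → β) (T : Set (α × β)) :
    (Prod.map a b) ⁻¹' T = ⋃ x ∈ T, (a ⁻¹' {x.1}) ×ˢ (b ⁻¹' {x.2}) := by
  ext ⟨x, y⟩
  simp

lemma rectRing_measurable {E₁ E₂ : Type*} [MeasurableSpace E₁] [MeasurableSpace E₂]
    {S : Set (E₁ × E₂)} (hS : S ∈ rectRing E₁ E₂) : MeasurableSet S := by
  obtain ⟨α, β, _, _, a, b, ha, hb, T, rfl⟩ := hS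
  rw [rectRing_eq_biUnion]
  exact MeasurableSet.biUnion (Set.to_countable _) fun x _ => (ha _).prod (hb _)

lemma rectRing_generate (E₁ E₂ : Type*) [MeasurableSpace E₁] [MeasurableSpace E₂] :
    (Prod.instMeasurableSpace : MeasurableSpace (E₁ × E₂)) =
      MeasurableSpace.generateFrom (rectRing E₁ E₂) := by
  apply le_antisymm
  · rw [← generateFrom_prod]
    apply MeasurableSpace.generateFrom_mono
    rintro _ ⟨s, hs, t, ht, rfl⟩
    have key : ∀ {E : Type _} [MeasurableSpace E] (u : Set E), MeasurableSet u → ∀ x : Prop,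
        MeasurableSet ((fun e => (e ∈ u : Prop)) ⁻¹' {x}) := by
      intro E _ u hu x
      by_cases hx : x
      · have : (fun e => (e ∈ u : Prop)) ⁻¹' {x} = u := by ext; simp [hx]
        rw [this]; exact hu
      · have : (fun e => (e ∈ u : Prop)) ⁻¹' {x} = uᶜ := by ext; simp [hx]
        rw [this]; exact hu.compl
    have key2 : ∀ {E : Type _} [MeasurableSpace E] (u : Set E), MeasurableSet u → ∀ x : Prop,
        MeasurableSet ((fun e => (e ∈ u : Prop)) ⁻¹' {x}) := by
      intro E _ u hu x
      by_cases hx : x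
      · have : (fun e => (e ∈ u : Prop)) ⁻¹' {x} = u := by ext; simp [hx]
        rw [this]; exact hu
      · have : (fun e => (e ∈ u : Prop)) ⁻¹' {x} = uᶜ := by ext; simp [hx]
        rw [this]; exact hu.compl
    refine ⟨Prop, Prop, inferInstance, inferInstance, fun e => e ∈ s, fun e => e ∈ t,
      key s hs, key2 t ht, {x | x.1 ∧ x.2}, ?_⟩
    ext ⟨x, y⟩; simp
  · apply MeasurableSpace.generateFrom_le
    intro S hS
    exact rectRing_measurable hS

lemma tv_of_rect {E₁ E₂ : Type*} [MeasurableSpace E₁] [MeasurableSpace E₂]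
    (ρ π : Measure (E₁ × E₂)) [IsProbabilityMeasure ρ] [IsProbabilityMeasure π] (c : ℝ)
    (hrect : ∀ (α β : Type) [Fintype α] [Fintype β] (a : E₁ → α) (b : E₂ → β),
      (∀ x, MeasurableSet (a ⁻¹' {x})) → (∀ x, MeasurableSet (b ⁻¹' {x})) →
      ∑ i, ∑ j, |ρ.real ((a ⁻¹' {i}) ×ˢ (b ⁻¹' {j})) - π.real ((a ⁻¹' {i}) ×ˢ (b ⁻¹' {j}))| ≤ c)
    {S : Set (E₁ × E₂)} (hS : MeasurableSet S) : |ρ.real S - π.real S| ≤ c := by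
  have hring : ∀ S ∈ rectRing E₁ E₂, |ρ.real S - π.real S| ≤ c := by
    rintro S ⟨α, β, _, _, a, b, ha, hb, T, rfl⟩
    classical
    have hsum : ∀ (ν : Measure (E₁ × E₂)) [IsProbabilityMeasure ν],
        ν.real ((Prod.map a b) ⁻¹' T) = ∑ x ∈ Finset.univ.filter (· ∈ T),
          ν.real ((a ⁻¹' {x.1}) ×ˢ (b ⁻¹' {x.2})) := by
      intro ν _
      rw [rectRing_eq_biUnion]
      have : (⋃ x ∈ T, (a ⁻¹' {x.1}) ×ˢ (b ⁻¹' {x.2})) =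
        ⋃ x ∈ Finset.univ.filter (· ∈ T), (a ⁻¹' {x.1}) ×ˢ (b ⁻¹' {x.2}) := by simp
      rw [this, measureReal_biUnion_finset]
      · intro x _ y _ hxy
        rw [Function.onFun, Set.disjoint_left]
        rintro ⟨e, f⟩ h1 h2
        simp only [mem_prod, mem_preimage, mem_singleton_iff] at h1 h2
        exact hxy (Prod.ext (h1.1.symm.trans h2.1) (h1.2.symm.trans h2.2))
      · intro x _
        exact (ha _).prod (hb _)
    rw [hsum ρ, hsum π, ← Finset.sum_sub_distrib]
    refine (Finset.abs_sum_le_sum_abs _ _).trans ?_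
    refine (Finset.sum_le_sum_of_subset_of_nonneg (Finset.filter_subset _ _)
      fun _ _ _ => abs_nonneg _).trans ?_
    rw [Fintype.sum_prod_type]
    exact hrect α β a b ha hb
  refine le_of_forall_pos_le_add fun ε hε => ?_
  obtain ⟨t, ht, hlt⟩ := exists_measure_symmDiff_lt_of_generateFrom_isSetRing (μ := ρ + π)
    (rectRing_isSetRing E₁ E₂)
    ⟨{univ}, by simp, by
      simp only [singleton_subset_iff]
      exact ⟨Unit, Unit, inferInstance, inferInstance, fun _ => (), fun _ => (),
        by simp, by simp, univ, by simp⟩, by simp⟩ (rectRing_generate E₁ E₂) hS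
    (ε := ENNReal.ofReal ε) (by simpa using hε)
  have htm := rectRing_measurable ht
  have hd : ∀ (ν : Measure (E₁ × E₂)) [IsProbabilityMeasure ν],
      |ν.real S - ν.real t| ≤ ν.real (symmDiff t S) := by
    intro ν _
    rw [symmDiff_comm]
    exact abs_measureReal_sub_le_measureReal_symmDiff hS.nullMeasurableSet htm.nullMeasurableSet
  have hsum : ρ.real (symmDiff t S) + π.real (symmDiff t S) < ε := by
    have : (ρ + π).real (symmDiff t S) < ε := by
      rw [measureReal_def]
      exact ENNReal.toReal_lt_of_lt_ofReal hlt
    rwa [measureReal_add_apply] at this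
  have h1 := hd ρ
  have h2 := hd π
  have h3 := hring t ht
  rw [abs_le] at *
  constructor <;> linarith

lemma tv_integral {E : Type*} [MeasurableSpace E]
    (ρ π : Measure E) [IsProbabilityMeasure ρ] [IsProbabilityMeasure π] (c : ℝ)
    (hc : ∀ S, MeasurableSet S → |ρ.real S - π.real S| ≤ c)
    (F : E → ℝ) (hF : Measurable F) (B : ℝ) (hB : ∀ x, |F x| ≤ B) :
    |∫ x, F x ∂ρ - ∫ x, F x ∂π| ≤ 2 * B * c := by
  have hB0 : 0 ≤ B := by
    obtain ⟨x⟩ : Nonempty E := by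
      by_contra hne
      rw [not_nonempty_iff] at hne
      exact (IsProbabilityMeasure.ne_zero ρ) (Measure.eq_zero_of_isEmpty ρ)
    exact (abs_nonneg _).trans (hB x)
  have hint : ∀ (ν : Measure E) [IsProbabilityMeasure ν], Integrable F ν := fun ν _ =>
    Integrable.of_bound hF.aestronglyMeasurable B (Eventually.of_forall hB)
  have hlay : ∀ (ν : Measure E) [IsProbabilityMeasure ν],
      ∫ x, F x ∂ν = (∫ t in Ioc 0 (2 * B), ν.real {a | t ≤ F a + B}) - B := by
    intro ν _
    have := Integrable.integral_eq_integral_Ioc_meas_le (μ := ν) (f := fun x => F x + B)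
      (M := 2 * B) ((hint ν).add (integrable_const B))
      (Eventually.of_forall fun x => by have := (abs_le.1 (hB x)).1; simp; linarith)
      (Eventually.of_forall fun x => by have := (abs_le.1 (hB x)).2; simp; linarith)
    rw [← this, integral_add (hint ν) (integrable_const B)]
    simp
  have hmeas : ∀ (ν : Measure E) [IsProbabilityMeasure ν],
      IntegrableOn (fun t => ν.real {a | t ≤ F a + B}) (Ioc 0 (2 * B)) := by
    intro ν _
    apply Measure.integrableOn_of_bounded (M := 1) measure_Ioc_lt_top.ne
    · refine (Antitone.measurable ?_).aestronglyMeasurable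
      intro s t hst
      exact measureReal_mono (fun a (ha : t ≤ F a + B) => hst.trans ha)
    · exact Eventually.of_forall fun t => by
        rw [Real.norm_eq_abs, abs_of_nonneg measureReal_nonneg]; exact measureReal_le_one
  rw [hlay ρ, hlay π, sub_sub_sub_cancel_right, ← integral_sub (hmeas ρ) (hmeas π)]
  have := norm_setIntegral_le_of_norm_le_const (μ := volume) (s := Ioc 0 (2 * B)) (C := c)
    (f := fun t => ρ.real {a | t ≤ F a + B} - π.real {a | t ≤ F a + B}) measure_Ioc_lt_top
    (fun t _ => hc _ (measurableSet_le measurable_const (hF.add_const B)))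
  rw [Real.norm_eq_abs] at this
  refine this.trans ?_
  simp [measureReal_def, hB0]
  linarith

end UQuantile

namespace UQuantile

lemma stat_fintype {Ω : Type*} [MeasurableSpace Ω] {P : Measure Ω} {X Z : ℤ → Ω → ℝ}
    (hX : ∀ i, Measurable (X i)) (hZ : ∀ i, Measurable (Z i))
    (hst : IsPairStationary P X Z) {ι : Type*} [Fintype ι] (idx : ι → ℤ) (k : ℤ) :
    P.map (fun ω i => (X (idx i) ω, Z (idx i) ω)) =
      P.map (fun ω i => (X (idx i + k) ω, Z (idx i + k) ω)) := by
  let e := Fintype.equivFin ι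
  have h := hst k _ (fun j => idx (e.symm j))
  have hg : Measurable (fun (v : Fin (Fintype.card ι) → ℝ × ℝ) (i : ι) => v (e i)) := by fun_prop
  have h' := congrArg (Measure.map (fun (v : Fin (Fintype.card ι) → ℝ × ℝ) (i : ι) => v (e i))) h
  rw [Measure.map_map hg (by fun_prop), Measure.map_map hg (by fun_prop)] at h'
  simpa [Function.comp_def] using h'

lemma stat_Z {Ω : Type*} [MeasurableSpace Ω] {P : Measure Ω} {X Z : ℤ → Ω → ℝ}
    (hX : ∀ i, Measurable (X i)) (hZ : ∀ i, Measurable (Z i))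
    (hst : IsPairStationary P X Z) {ι : Type*} [Fintype ι] (idx : ι → ℤ) (k : ℤ) :
    P.map (fun ω i => Z (idx i) ω) = P.map (fun ω i => Z (idx i + k) ω) := by
  have h := stat_fintype hX hZ hst idx k
  have hg : Measurable (fun (v : ι → ℝ × ℝ) (i : ι) => (v i).2) := by fun_prop
  have h' := congrArg (Measure.map (fun (v : ι → ℝ × ℝ) (i : ι) => (v i).2)) h
  rw [Measure.map_map hg (by fun_prop), Measure.map_map hg (by fun_prop)] at h'
  simpa [Function.comp_def] using h'

lemma stat_Z_pair {Ω : Type*} [MeasurableSpace Ω] {P : Measure Ω} {X Z : ℤ → Ω → ℝ}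
    (hX : ∀ i, Measurable (X i)) (hZ : ∀ i, Measurable (Z i))
    (hst : IsPairStationary P X Z) {ι₁ ι₂ : Type*} [Fintype ι₁] [Fintype ι₂]
    (idx₁ : ι₁ → ℤ) (idx₂ : ι₂ → ℤ) (k : ℤ) :
    P.map (fun ω => ((fun i => Z (idx₁ i) ω), (fun i => Z (idx₂ i) ω))) =
      P.map (fun ω => ((fun i => Z (idx₁ i + k) ω), (fun i => Z (idx₂ i + k) ω))) := by
  have h := stat_Z hX hZ hst (Sum.elim idx₁ idx₂) k
  let g : (ι₁ ⊕ ι₂ → ℝ) → (ι₁ → ℝ) × (ι₂ → ℝ) := fun v => (fun i => v (.inl i), fun i => v (.inr i))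
  have hg : Measurable g := by fun_prop
  have h' := congrArg (Measure.map g) h
  rw [Measure.map_map hg (by fun_prop), Measure.map_map hg (by fun_prop)] at h'
  simpa [Function.comp_def, g] using h'

lemma beta_fintype {Ω : Type*} [MeasurableSpace Ω] {P : Measure Ω} {Z : ℤ → Ω → ℝ}
    {β : ℕ → ℝ} (hβ : IsBetaBound P Z β) (k : ℕ) (α γ : Type) [Fintype α] [Fintype γ]
    (a : Ω → α) (b : Ω → γ) (ha : ∀ x, MeasurableSet[pastSigma Z] (a ⁻¹' {x}))
    (hb : ∀ x, MeasurableSet[futureSigma Z k] (b ⁻¹' {x})) :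
    ∑ i, ∑ j, |P.real (a ⁻¹' {i} ∩ b ⁻¹' {j}) - P.real (a ⁻¹' {i}) * P.real (b ⁻¹' {j})|
      ≤ 2 * β k := by
  let e := Fintype.equivFin α
  let f := Fintype.equivFin γ
  have h := hβ k _ _ (fun i => a ⁻¹' {e.symm i}) (fun j => b ⁻¹' {f.symm j})
    (fun i => ha _) (fun j => hb _)
    (by
      intro i j hij
      rw [Function.onFun, Set.disjoint_left]
      intro x h1 h2
      simp only [mem_preimage, mem_singleton_iff] at h1 h2
      exact hij (e.symm.injective (h1.symm.trans h2)))
    (by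
      intro i j hij
      rw [Function.onFun, Set.disjoint_left]
      intro x h1 h2
      simp only [mem_preimage, mem_singleton_iff] at h1 h2
      exact hij (f.symm.injective (h1.symm.trans h2)))
    (by
      ext x
      simp only [mem_iUnion, mem_preimage, mem_singleton_iff, mem_univ, iff_true]
      exact ⟨e (a x), by simp⟩)
    (by
      ext x
      simp only [mem_iUnion, mem_preimage, mem_singleton_iff, mem_univ, iff_true]
      exact ⟨f (b x), by simp⟩)
  have h2 : ∑ i, ∑ j, |P.real (a ⁻¹' {i} ∩ b ⁻¹' {j}) - P.real (a ⁻¹' {i}) * P.real (b ⁻¹' {j})|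
     = ∑ i, ∑ j, |(P (a ⁻¹' {e.symm i} ∩ b ⁻¹' {f.symm j})).toReal -
        (P (a ⁻¹' {e.symm i})).toReal * (P (b ⁻¹' {f.symm j})).toReal| := by
    rw [← e.symm.sum_comp]
    refine Finset.sum_congr rfl fun i _ => ?_
    rw [← f.symm.sum_comp]
    rfl
  rw [h2]
  linarith

lemma meas_past {Ω : Type*} {Z : ℤ → Ω → ℝ} (i : ℤ) (hi : i ≤ 0) :
    Measurable[pastSigma Z] (Z i) :=
  Measurable.mono (comap_measurable (Z i))
    (le_iSup (fun i : {i : ℤ // i ≤ 0} => MeasurableSpace.comap (Z i) Real.measurableSpace) ⟨i, hi⟩)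
    le_rfl

lemma meas_future {Ω : Type*} {Z : ℤ → Ω → ℝ} (k : ℕ) (i : ℤ) (hi : (k : ℤ) ≤ i) :
    Measurable[futureSigma Z k] (Z i) :=
  Measurable.mono (comap_measurable (Z i))
    (le_iSup (fun i : {i : ℤ // (k : ℤ) ≤ i} =>
      MeasurableSpace.comap (Z i) Real.measurableSpace) ⟨i, hi⟩) le_rfl

/-- Decoupling under absolute regularity. -/
lemma beta_decouple {Ω : Type*} [MeasurableSpace Ω] {P : Measure Ω} [IsProbabilityMeasure P]
    {X Z : ℤ → Ω → ℝ}
    (hX : ∀ i, Measurable (X i)) (hZ : ∀ i, Measurable (Z i))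
    (hst : IsPairStationary P X Z) {β : ℕ → ℝ} (hβ : IsBetaBound P Z β)
    {ι₁ ι₂ : Type*} [Fintype ι₁] [Fintype ι₂]
    (idx₁ : ι₁ → ℤ) (idx₂ : ι₂ → ℤ) (c : ℤ) (k : ℕ) (h₁ : ∀ i, idx₁ i ≤ c)
    (h₂ : ∀ i, c + k ≤ idx₂ i)
    (F : (ι₁ → ℝ) × (ι₂ → ℝ) → ℝ) (hF : Measurable F) (B : ℝ) (hB : ∀ x, |F x| ≤ B) :
    |∫ ω, F ((fun i => Z (idx₁ i) ω), (fun i => Z (idx₂ i) ω)) ∂P -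
      ∫ p, F ((fun i => Z (idx₁ i) p.1), (fun i => Z (idx₂ i) p.2)) ∂(P.prod P)| ≤
      4 * B * β k := by
  let V : Ω → ι₁ → ℝ := fun ω i => Z (idx₁ i) ω
  let W : Ω → ι₂ → ℝ := fun ω i => Z (idx₂ i) ω
  let V' : Ω → ι₁ → ℝ := fun ω i => Z (idx₁ i + -c) ω
  let W' : Ω → ι₂ → ℝ := fun ω i => Z (idx₂ i + -c) ω
  have hV : Measurable V := by fun_prop
  have hW : Measurable W := by fun_prop
  have hV' : Measurable V' := by fun_prop
  have hW' : Measurable W' := by fun_prop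
  have hV'p : Measurable[pastSigma Z] V' :=
    (@measurable_pi_iff _ _ _ (pastSigma Z) _ _).2 fun i => meas_past _ (by linarith [h₁ i])
  have hW'p : Measurable[futureSigma Z k] W' :=
    (@measurable_pi_iff _ _ _ (futureSigma Z k) _ _).2 fun i =>
      meas_future _ _ (by linarith [h₂ i])
  have e1 : P.map (fun ω => (V ω, W ω)) = P.map (fun ω => (V' ω, W' ω)) :=
    stat_Z_pair hX hZ hst idx₁ idx₂ (-c)
  have e2 : P.map V = P.map V' := stat_Z hX hZ hst idx₁ (-c)
  have e3 : P.map W = P.map W' := stat_Z hX hZ hst idx₂ (-c)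
  have i1 : ∫ ω, F (V ω, W ω) ∂P = ∫ x, F x ∂(P.map (fun ω => (V' ω, W' ω))) := by
    rw [← e1, integral_map (by fun_prop) hF.aestronglyMeasurable]
  have i2 : ∫ p, F (V p.1, W p.2) ∂(P.prod P) = ∫ x, F x ∂((P.map V').prod (P.map W')) := by
    rw [← e2, ← e3, Measure.map_prod_map _ _ hV hW,
      integral_map (by fun_prop) hF.aestronglyMeasurable]
    rfl
  change |∫ ω, F (V ω, W ω) ∂P - ∫ p, F (V p.1, W p.2) ∂(P.prod P)| ≤ _
  rw [i1, i2]
  have : IsProbabilityMeasure (P.map (fun ω => (V' ω, W' ω))) :=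
    Measure.isProbabilityMeasure_map (by fun_prop)
  have : IsProbabilityMeasure (P.map V') := Measure.isProbabilityMeasure_map (by fun_prop)
  have : IsProbabilityMeasure (P.map W') := Measure.isProbabilityMeasure_map (by fun_prop)
  refine (tv_integral _ _ (2 * β k) ?_ F hF B hB).trans (by linarith)
  intro S hS
  refine tv_of_rect _ _ _ ?_ hS
  intro α γ _ _ a b ha hb
  have := beta_fintype hβ k α γ (a ∘ V') (b ∘ W') (fun x => hV'p (ha x)) (fun x => hW'p (hb x))
  refine le_trans (le_of_eq ?_) this
  refine Finset.sum_congr rfl fun i _ => Finset.sum_congr rfl fun j _ => ?_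
  rw [measureReal_prod_prod, map_measureReal_apply (by fun_prop) ((ha i).prod (hb j)),
    map_measureReal_apply hV' (ha i), map_measureReal_apply hW' (hb j)]
  rfl

/-- A bound on the mixing coefficients with a quadratic rate. -/
lemma beta_rate {Ω : Type*} [MeasurableSpace Ω] {P : Measure Ω} {Z : ℤ → Ω → ℝ}
    {β : ℕ → ℝ} (hβ0 : ∀ k, 0 ≤ β k) (hβ : IsBetaBound P Z β)
    (hs : Summable fun k : ℕ => (k : ℝ) * β k) :
    ∃ C : ℝ, 0 ≤ C ∧ IsBetaBound P Z (fun k => C / (k : ℝ) ^ 2 + if k = 0 then β 0 else 0) := by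
  refine ⟨2 * ∑' k : ℕ, (k : ℝ) * β k,
    mul_nonneg (by norm_num) (tsum_nonneg fun k => mul_nonneg (by positivity) (hβ0 k)), ?_⟩
  intro k m m' A B hA hB dA dB uA uB
  rcases Nat.eq_zero_or_pos k with rfl | hk
  · simpa using hβ 0 m m' A B hA hB dA dB uA uB
  set T := (1 / 2 : ℝ) * ∑ i, ∑ j,
        |(P (A i ∩ B j)).toReal - (P (A i)).toReal * (P (B j)).toReal| with hT
  have hT0 : 0 ≤ T := by positivity
  have hle : ∀ j ≤ k, T ≤ β j := by
    intro j hj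
    refine hβ j m m' A B hA (fun i => ?_) dA dB uA uB
    have hle : futureSigma Z k ≤ futureSigma Z j := by
      refine iSup_le fun i => ?_
      exact le_iSup (fun i : {i : ℤ // (j : ℤ) ≤ i} =>
        MeasurableSpace.comap (Z i) Real.measurableSpace) ⟨i.1, by have := i.2; omega⟩
    exact hle _ (hB i)
  have h1 : ∑ j ∈ Finset.range (k + 1), (j : ℝ) * T ≤ ∑' j : ℕ, (j : ℝ) * β j := by
    refine le_trans (Finset.sum_le_sum fun j hj => ?_)
      (hs.sum_le_tsum (Finset.range (k + 1)) fun i _ => mul_nonneg (by positivity) (hβ0 i))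
    exact mul_le_mul_of_nonneg_left (hle j (by simpa [Nat.lt_succ_iff] using hj)) (by positivity)
  rw [← Finset.sum_mul] at h1
  have h2 : (∑ j ∈ Finset.range (k + 1), (j : ℝ)) * 2 = (k + 1) * k := by
    have := Finset.sum_range_id_mul_two (k + 1)
    simp only [Nat.add_sub_cancel] at this
    rw [← Nat.cast_sum]
    exact_mod_cast this
  have hk' : (0 : ℝ) < k := by exact_mod_cast hk
  simp only [hk.ne', if_false, add_zero]
  rw [le_div_iff₀ (by positivity)]
  nlinarith

end UQuantile

namespace UQuantile

/-- Local variation of `g` at `q`. -/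
def supVar (g : ℝ → ℝ → ℝ) (ε : ℝ) (q : ℝ × ℝ) : ℝ :=
  ⨆ r ∈ Metric.closedBall q ε, |g r.1 r.2 - g q.1 q.2|

lemma le_supVar {g : ℝ → ℝ → ℝ} {M : ℝ} (g0 : ∀ x y, 0 ≤ g x y) (gM : ∀ x y, g x y ≤ M)
    {ε : ℝ} {q r : ℝ × ℝ} (hr : r ∈ Metric.closedBall q ε) :
    |g r.1 r.2 - g q.1 q.2| ≤ supVar g ε q := by
  have hb : ∀ r : ℝ × ℝ, |g r.1 r.2 - g q.1 q.2| ≤ M := fun r =>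
    abs_le.2 ⟨by linarith [g0 r.1 r.2, gM q.1 q.2], by linarith [gM r.1 r.2, g0 q.1 q.2]⟩
  have hM : 0 ≤ M := (abs_nonneg _).trans (hb q)
  have hbdd : BddAbove (range fun r : ℝ × ℝ =>
      ⨆ (_ : r ∈ Metric.closedBall q ε), |g r.1 r.2 - g q.1 q.2|) := by
    refine ⟨M, ?_⟩
    rintro _ ⟨r, rfl⟩
    exact Real.iSup_le (fun _ => hb r) hM
  refine le_trans ?_ (le_ciSup hbdd r)
  rw [ciSup_pos hr]

lemma supVar_nonneg (g : ℝ → ℝ → ℝ) (ε : ℝ) (q : ℝ × ℝ) : 0 ≤ supVar g ε q :=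
  Real.iSup_nonneg fun _ => Real.iSup_nonneg fun _ => abs_nonneg _

lemma lintegral_le_of_fst {E E' : Type*} [MeasurableSpace E] [MeasurableSpace E']
    [StandardBorelSpace E'] [Nonempty E'] (ρ : Measure (E × E')) [IsProbabilityMeasure ρ]
    (f : E × E' → ℝ≥0∞) (hf : Measurable f) (s : E → ℝ≥0∞) (hs : ∀ e e', f (e, e') ≤ s e) :
    ∫⁻ x, f x ∂ρ ≤ ∫⁻ e, s e ∂ρ.fst := by
  rw [← Measure.lintegral_condKernel hf]
  refine lintegral_mono fun e => ?_
  calc ∫⁻ ω, f (e, ω) ∂(ρ.condKernel e) ≤ ∫⁻ _, s e ∂(ρ.condKernel e) :=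
        lintegral_mono fun e' => hs e e'
    _ = s e := by simp

/-- Variation condition applied to a pair of independent (value, approximation) couples. -/
lemma var_master {g : ℝ → ℝ → ℝ} {μ : Measure ℝ}
    {L ε' δ : ℝ} (hδ : 0 < δ)
    (hvar : ∫⁻ q, ENNReal.ofReal (supVar g ε' q ^ 2) ∂(μ.prod μ) ≤ ENNReal.ofReal (L * ε'))
    (hL : 0 ≤ L * ε')
    (ν : Measure (ℝ × ℝ)) [IsProbabilityMeasure ν] (hν : ν.fst = μ)
    (G : (ℝ × ℝ) × (ℝ × ℝ) → ℝ) (hG : Measurable G) (hG0 : ∀ z, 0 ≤ G z)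
    (hGS : ∀ z, G z ≤ 2 * supVar g ε' (z.1.1, z.2.1)) :
    ∫ z, G z ∂(ν.prod ν) ≤ L * ε' / δ + δ := by
  rw [integral_eq_lintegral_of_nonneg_ae (Eventually.of_forall hG0) hG.aestronglyMeasurable]
  refine ENNReal.toReal_le_of_le_ofReal (by positivity) ?_
  let T : (ℝ × ℝ) × (ℝ × ℝ) → (ℝ × ℝ) × (ℝ × ℝ) := fun z => ((z.1.1, z.2.1), (z.1.2, z.2.2))
  have hT : Measurable T := by fun_prop
  have hTT : ∀ z, T (T z) = z := fun z => rfl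
  let ρ := (ν.prod ν).map T
  have : IsProbabilityMeasure ρ := Measure.isProbabilityMeasure_map hT.aemeasurable
  have hρ : ρ.fst = μ.prod μ := by
    rw [← hν, Measure.fst, Measure.map_map measurable_fst hT, Measure.fst,
      Measure.map_prod_map _ _ measurable_fst measurable_fst]
    rfl
  have e1 : ∫⁻ z, ENNReal.ofReal (G z) ∂(ν.prod ν) = ∫⁻ w, ENNReal.ofReal (G (T w)) ∂ρ := by
    rw [lintegral_map (by fun_prop) hT]
  rw [e1]
  refine (lintegral_le_of_fst ρ _ (by fun_prop)
    (fun q => ENNReal.ofReal δ⁻¹ * ENNReal.ofReal (supVar g ε' q ^ 2) + ENNReal.ofReal δ) ?_).trans ?_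
  · intro q r
    rw [← ENNReal.ofReal_mul (by positivity), ← ENNReal.ofReal_add (by positivity) hδ.le]
    refine ENNReal.ofReal_le_ofReal ((hGS _).trans ?_)
    change 2 * supVar g ε' q ≤ _
    have h1 : 0 ≤ δ⁻¹ * (supVar g ε' q - δ) ^ 2 := by positivity
    have h2 : δ⁻¹ * (supVar g ε' q - δ) ^ 2 =
      δ⁻¹ * supVar g ε' q ^ 2 + δ - 2 * supVar g ε' q := by field_simp; ring
    linarith
  · rw [hρ, lintegral_add_right _ measurable_const, lintegral_const_mul' _ _ ENNReal.ofReal_ne_top]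
    have hμ : IsProbabilityMeasure μ := by rw [← hν]; infer_instance
    simp only [lintegral_const, measure_univ, mul_one]
    rw [ENNReal.ofReal_add (by positivity) hδ.le, div_eq_inv_mul,
      ENNReal.ofReal_mul (by positivity)]
    gcongr

/-- Version with an exceptional set. -/
lemma var_master' {g : ℝ → ℝ → ℝ} {μ : Measure ℝ}
    {L ε' δ ε η M : ℝ} (hδ : 0 < δ)
    (hvar : ∫⁻ q, ENNReal.ofReal (supVar g ε' q ^ 2) ∂(μ.prod μ) ≤ ENNReal.ofReal (L * ε'))
    (hL : 0 ≤ L * ε')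
    (ν : Measure (ℝ × ℝ)) [IsProbabilityMeasure ν] (hν : ν.fst = μ)
    (hbad : ν.real {z | ε < |z.1 - z.2|} ≤ η)
    (G : (ℝ × ℝ) × (ℝ × ℝ) → ℝ) (hG : Measurable G) (hG0 : ∀ z, 0 ≤ G z) (hGM : ∀ z, G z ≤ M)
    (hGS : ∀ z, |z.1.1 - z.1.2| ≤ ε → |z.2.1 - z.2.2| ≤ ε →
      G z ≤ 2 * supVar g ε' (z.1.1, z.2.1)) :
    ∫ z, G z ∂(ν.prod ν) ≤ L * ε' / δ + δ + 2 * (M * η) := by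
  let bad : Set (ℝ × ℝ) := {z | ε < |z.1 - z.2|}
  have hbadm : MeasurableSet bad := measurableSet_lt measurable_const (by fun_prop)
  let bad2 : Set ((ℝ × ℝ) × (ℝ × ℝ)) := (Prod.fst ⁻¹' bad) ∪ (Prod.snd ⁻¹' bad)
  have hbad2m : MeasurableSet bad2 := (measurable_fst hbadm).union (measurable_snd hbadm)
  have hM : 0 ≤ M := (hG0 0).trans (hGM 0)
  have hGi : Integrable G (ν.prod ν) := Integrable.of_bound hG.aestronglyMeasurable M
    (Eventually.of_forall fun z => by rw [Real.norm_eq_abs, abs_of_nonneg (hG0 z)]; exact hGM z)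
  rw [← integral_add_compl hbad2m hGi]
  have h1 : ∫ z in bad2ᶜ, G z ∂(ν.prod ν) ≤ L * ε' / δ + δ := by
    rw [← integral_indicator hbad2m.compl]
    refine var_master hδ hvar hL ν hν _ (hG.indicator hbad2m.compl)
      (fun z => indicator_nonneg (fun z _ => hG0 z) z) fun z => ?_
    by_cases hz : z ∈ bad2ᶜ
    · rw [indicator_of_mem hz]
      simp only [bad2, bad, mem_compl_iff, mem_union, mem_preimage, mem_ofPred_eq, not_or,
        not_lt] at hz
      exact hGS z hz.1 hz.2
    · rw [indicator_of_notMem hz]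
      exact mul_nonneg (by norm_num) (supVar_nonneg _ _ _)
  have h2 : ∫ z in bad2, G z ∂(ν.prod ν) ≤ 2 * (M * η) := by
    have hm : (ν.prod ν).real bad2 ≤ 2 * η := by
      refine (measureReal_union_le _ _).trans ?_
      have e1 : (ν.prod ν).real (Prod.fst ⁻¹' bad) = ν.real bad := by
        rw [← prod_univ, measureReal_prod_prod]; simp
      have e2 : (ν.prod ν).real (Prod.snd ⁻¹' bad) = ν.real bad := by
        rw [← univ_prod, measureReal_prod_prod]; simp
      rw [e1, e2]; linarith
    have := norm_setIntegral_le_of_norm_le_const (μ := ν.prod ν) (s := bad2) (C := M) (f := G)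
      (measure_lt_top _ _)
      (fun z _ => by rw [Real.norm_eq_abs, abs_of_nonneg (hG0 z)]; exact hGM z)
    refine (le_abs_self _).trans (this.trans ?_)
    nlinarith
  linarith

/-- Approximate independence of two random elements. -/
def Decoup {Ω E₁ E₂ : Type*} [MeasurableSpace Ω] [MeasurableSpace E₁] [MeasurableSpace E₂]
    (P : Measure Ω) (V : Ω → E₁) (W : Ω → E₂) (b : ℝ) : Prop :=
  ∀ F : E₁ × E₂ → ℝ, Measurable F → ∀ B, (∀ x, |F x| ≤ B) →
    |∫ ω, F (V ω, W ω) ∂P - ∫ p, F (V p.1, W p.2) ∂(P.prod P)| ≤ 4 * B * b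

lemma Decoup.symm {Ω E₁ E₂ : Type*} [MeasurableSpace Ω] [MeasurableSpace E₁] [MeasurableSpace E₂]
    {P : Measure Ω} [IsProbabilityMeasure P] {V : Ω → E₁} {W : Ω → E₂} {b : ℝ}
    (h : Decoup P V W b) : Decoup P W V b := by
  intro F hF B hB
  have := h (F ∘ Prod.swap) (hF.comp measurable_swap) B (fun x => hB _)
  rw [← integral_prod_swap]
  exact this

lemma Decoup.comp {Ω E₁ E₂ E₃ E₄ : Type*} [MeasurableSpace Ω] [MeasurableSpace E₁]
    [MeasurableSpace E₂] [MeasurableSpace E₃] [MeasurableSpace E₄]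
    {P : Measure Ω} {V : Ω → E₁} {W : Ω → E₂} {b : ℝ}
    (h : Decoup P V W b) {u : E₁ → E₃} {v : E₂ → E₄} (hu : Measurable u) (hv : Measurable v) :
    Decoup P (fun ω => u (V ω)) (fun ω => v (W ω)) b := by
  intro F hF B hB
  exact h (fun x => F (u x.1, v x.2)) (by fun_prop) B (fun x => hB _)

/-- All the facts on a process `X`, its approximation `Y` and a kernel `g` used below. -/
structure Ctx {Ω : Type*} [MeasurableSpace Ω] (P : Measure Ω) (X Y : ℤ → Ω → ℝ)
    (g : ℝ → ℝ → ℝ) (M ε θ η b : ℝ) : Prop where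
  hX : ∀ i, Measurable (X i)
  hY : ∀ i, Measurable (Y i)
  hg : Measurable (fun q : ℝ × ℝ => g q.1 q.2)
  g0 : ∀ x y, 0 ≤ g x y
  gM : ∀ x y, g x y ≤ M
  gs : ∀ x y, g x y = g y x
  law : ∀ i, P.map (fun ω => (X i ω, Y i ω)) = P.map (fun ω => (X 0 ω, Y 0 ω))
  bad : P.real {ω | ε < |X 0 ω - Y 0 ω|} ≤ η
  hvar : ∃ L δ : ℝ, 0 < δ ∧ 0 ≤ L * (2 * ε) ∧ L * (2 * ε) / δ + δ ≤ θ ∧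
    ∫⁻ q, ENNReal.ofReal (supVar g (2 * ε) q ^ 2) ∂((P.map (X 0)).prod (P.map (X 0))) ≤
      ENNReal.ofReal (L * (2 * ε))
  hη : M * η ≤ θ
  hb : M * b ≤ θ
  hε : 0 < ε

set_option linter.unusedSectionVars false

section ctx
variable {Ω : Type*} [MeasurableSpace Ω] {P : Measure Ω} [IsProbabilityMeasure P]
  {X Y : ℤ → Ω → ℝ} {g : ℝ → ℝ → ℝ} {M ε θ η b : ℝ}

lemma Ctx.mul_bad (c : Ctx P X Y g M ε θ η b) (i : ℤ) :
    P.real {ω | ε < |X i ω - Y i ω|} ≤ η := by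
  refine le_trans (le_of_eq ?_) c.bad
  have hm : MeasurableSet {z : ℝ × ℝ | ε < |z.1 - z.2|} :=
    measurableSet_lt measurable_const (by fun_prop)
  have h := congrArg (fun m => m.real {z : ℝ × ℝ | ε < |z.1 - z.2|}) (c.law i)
  have := c.hX; have := c.hY
  rw [map_measureReal_apply (by fun_prop) hm, map_measureReal_apply (by fun_prop) hm] at h
  exact h

lemma Ctx.M0 (c : Ctx P X Y g M ε θ η b) : 0 ≤ M := (c.g0 0 0).trans (c.gM 0 0)

lemma Ctx.η0 (c : Ctx P X Y g M ε θ η b) : 0 ≤ η := measureReal_nonneg.trans c.bad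

lemma Ctx.gabs (c : Ctx P X Y g M ε θ η b) (x y u v : ℝ) : |g x y - g u v| ≤ M :=
  abs_le.2 ⟨by linarith [c.g0 x y, c.gM u v], by linarith [c.gM x y, c.g0 u v]⟩

lemma Ctx.master (c : Ctx P X Y g M ε θ η b) (p q : ℤ)
    (G : (ℝ × ℝ) × (ℝ × ℝ) → ℝ) (hG : Measurable G) (hG0 : ∀ z, 0 ≤ G z) (hGM : ∀ z, G z ≤ M)
    (hGS : ∀ z, |z.1.1 - z.1.2| ≤ ε → |z.2.1 - z.2.2| ≤ ε →
      G z ≤ 2 * supVar g (2 * ε) (z.1.1, z.2.1)) :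
    ∫ z, G ((X p z.1, Y p z.1), (X q z.2, Y q z.2)) ∂(P.prod P) ≤ 3 * θ := by
  have hX := c.hX
  have hY := c.hY
  obtain ⟨L, δ, hδ, hL, hθ, hv⟩ := c.hvar
  have hm : MeasurableSet {z : ℝ × ℝ | ε < |z.1 - z.2|} :=
    measurableSet_lt measurable_const (by fun_prop)
  have : IsProbabilityMeasure (P.map (fun ω => (X 0 ω, Y 0 ω))) :=
    Measure.isProbabilityMeasure_map (by fun_prop)
  have h := var_master' (M := M) (ε := ε) (η := η) hδ hv hL (P.map (fun ω => (X 0 ω, Y 0 ω)))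
    (by rw [Measure.fst, Measure.map_map measurable_fst (by fun_prop)]; rfl)
    (by rw [map_measureReal_apply (by fun_prop) hm]; exact c.bad) G hG hG0 hGM hGS
  have e : ∫ z, G z ∂((P.map (fun ω => (X 0 ω, Y 0 ω))).prod (P.map (fun ω => (X 0 ω, Y 0 ω)))) =
     ∫ z, G ((X p z.1, Y p z.1), (X q z.2, Y q z.2)) ∂(P.prod P) := by
    nth_rewrite 1 [← c.law p]
    rw [← c.law q, Measure.map_prod_map _ _ (by fun_prop) (by fun_prop),
      integral_map (by fun_prop) hG.aestronglyMeasurable]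
    rfl
  rw [e] at h
  linarith [c.hη]

end ctx

end UQuantile

namespace UQuantile

/-- One-variable marginal mean of `g`. -/
def m1 (μ : Measure ℝ) (g : ℝ → ℝ → ℝ) (x : ℝ) : ℝ := ∫ y, g x y ∂μ

/-- Degenerate part of `g`. -/
def HH (μ : Measure ℝ) (g : ℝ → ℝ → ℝ) (x y : ℝ) : ℝ :=
  g x y - m1 μ g x - m1 μ g y + ∫ z, m1 μ g z ∂μ

section ctx
variable {Ω : Type*} [MeasurableSpace Ω] {P : Measure Ω} [IsProbabilityMeasure P]
  {X Y : ℤ → Ω → ℝ} {g : ℝ → ℝ → ℝ} {M ε θ η b : ℝ}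

lemma integrable_bdd {E : Type*} [MeasurableSpace E] {ν : Measure E} [IsFiniteMeasure ν]
    {f : E → ℝ} (hf : Measurable f) {B : ℝ} (hB : ∀ x, |f x| ≤ B) : Integrable f ν :=
  Integrable.of_bound hf.aestronglyMeasurable B (Eventually.of_forall hB)

lemma m1_meas (μ : Measure ℝ) [IsProbabilityMeasure μ]
    (hg : Measurable (fun q : ℝ × ℝ => g q.1 q.2)) : Measurable (m1 μ g) :=
  (StronglyMeasurable.integral_prod_right (f := g) hg.stronglyMeasurable).measurable

lemma g_sec_int (μ : Measure ℝ) [IsProbabilityMeasure μ]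
    (hg : Measurable (fun q : ℝ × ℝ => g q.1 q.2)) (g0 : ∀ x y, 0 ≤ g x y)
    (gM : ∀ x y, g x y ≤ M) (x : ℝ) : Integrable (g x) μ := by
  have : Measurable (g x) := hg.comp (measurable_const.prodMk measurable_id)
  exact integrable_bdd this (B := M) fun y => abs_le.2 ⟨by linarith [g0 x y, gM x y], gM x y⟩

lemma m1_nonneg (μ : Measure ℝ) (g0 : ∀ x y, 0 ≤ g x y) (x : ℝ) : 0 ≤ m1 μ g x :=
  integral_nonneg fun y => g0 x y

lemma m1_le (μ : Measure ℝ) [IsProbabilityMeasure μ]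
    (hg : Measurable (fun q : ℝ × ℝ => g q.1 q.2)) (g0 : ∀ x y, 0 ≤ g x y)
    (gM : ∀ x y, g x y ≤ M) (x : ℝ) : m1 μ g x ≤ M := by
  have := integral_mono (g_sec_int μ hg g0 gM x) (integrable_const M) (fun y => gM x y)
  simpa [m1] using this

lemma m1_int (μ : Measure ℝ) [IsProbabilityMeasure μ]
    (hg : Measurable (fun q : ℝ × ℝ => g q.1 q.2)) (g0 : ∀ x y, 0 ≤ g x y)
    (gM : ∀ x y, g x y ≤ M) : Integrable (m1 μ g) μ :=
  integrable_bdd (m1_meas μ hg) (B := M) fun y =>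
    abs_le.2 ⟨by linarith [m1_nonneg μ g0 y, m1_le μ hg g0 gM y], m1_le μ hg g0 gM y⟩

lemma HH_meas (μ : Measure ℝ) [IsProbabilityMeasure μ]
    (hg : Measurable (fun q : ℝ × ℝ => g q.1 q.2)) :
    Measurable (fun q : ℝ × ℝ => HH μ g q.1 q.2) := by
  have := m1_meas μ hg
  unfold HH
  fun_prop

lemma HH_abs (μ : Measure ℝ) [IsProbabilityMeasure μ]
    (hg : Measurable (fun q : ℝ × ℝ => g q.1 q.2)) (g0 : ∀ x y, 0 ≤ g x y)
    (gM : ∀ x y, g x y ≤ M) (x y : ℝ) : |HH μ g x y| ≤ 2 * M := by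
  have h1 : 0 ≤ ∫ z, m1 μ g z ∂μ := integral_nonneg fun y => m1_nonneg μ g0 y
  have h2 : ∫ z, m1 μ g z ∂μ ≤ M := by
    have := integral_mono (m1_int μ hg g0 gM) (integrable_const M) (fun y => m1_le μ hg g0 gM y)
    simpa using this
  have h3 := m1_nonneg μ g0 x
  have h4 := m1_nonneg μ g0 y
  have h5 := m1_le μ hg g0 gM x
  have h6 := m1_le μ hg g0 gM y
  have h7 := g0 x y
  have h8 := gM x y
  unfold HH
  rw [abs_le]
  constructor <;> linarith

lemma HH_symm (μ : Measure ℝ) (gs : ∀ x y, g x y = g y x) (x y : ℝ) :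
    HH μ g x y = HH μ g y x := by
  unfold HH
  rw [gs x y]; ring

lemma HH_degen (μ : Measure ℝ) [IsProbabilityMeasure μ]
    (hg : Measurable (fun q : ℝ × ℝ => g q.1 q.2)) (g0 : ∀ x y, 0 ≤ g x y)
    (gM : ∀ x y, g x y ≤ M) (gs : ∀ x y, g x y = g y x) (y : ℝ) :
    ∫ x, HH μ g x y ∂μ = 0 := by
  have hi : Integrable (fun x => g x y) μ := by
    have h0 : g y = fun x => g x y := funext (gs y)
    rw [← h0]
    exact g_sec_int μ hg g0 gM y
  have hm := m1_int μ hg g0 gM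
  have h1 : Integrable (fun x => g x y - m1 μ g x) μ := hi.sub hm
  have h2 : Integrable (fun x => g x y - m1 μ g x - m1 μ g y) μ := h1.sub (integrable_const _)
  unfold HH
  rw [integral_add h2 (integrable_const _),
    integral_sub h1 (integrable_const _), integral_sub hi hm]
  have : ∫ x, g x y ∂μ = m1 μ g y := by
    unfold m1; congr 1; ext x; exact gs x y
  rw [this]
  simp

lemma Ctx.indep_g (c : Ctx P X Y g M ε θ η b) (p q : ℤ) :
    ∫ z, |g (X p z.1) (X q z.2) - g (Y p z.1) (Y q z.2)| ∂(P.prod P) ≤ 3 * θ := by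
  have hg := c.hg
  refine c.master p q (fun z => |g z.1.1 z.2.1 - g z.1.2 z.2.2|) ?_
    (fun z => abs_nonneg _) (fun z => c.gabs _ _ _ _) ?_
  · have h1 : Measurable fun z : (ℝ × ℝ) × (ℝ × ℝ) => g z.1.1 z.2.1 :=
      hg.comp (f := fun z : (ℝ × ℝ) × (ℝ × ℝ) => (z.1.1, z.2.1)) (by fun_prop)
    have h2 : Measurable fun z : (ℝ × ℝ) × (ℝ × ℝ) => g z.1.2 z.2.2 :=
      hg.comp (f := fun z : (ℝ × ℝ) × (ℝ × ℝ) => (z.1.2, z.2.2)) (by fun_prop)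
    exact (h1.sub h2).abs
  · intro z h1 h2
    have := le_supVar c.g0 c.gM (ε := 2 * ε) (q := (z.1.1, z.2.1)) (r := (z.1.2, z.2.2)) (by
      have := c.hε
      rw [Metric.mem_closedBall, Prod.dist_eq, max_le_iff, Real.dist_eq, Real.dist_eq,
        abs_sub_comm, abs_sub_comm z.2.2]
      constructor <;> simp <;> linarith)
    rw [abs_sub_comm]
    exact this.trans (by linarith [supVar_nonneg g (2 * ε) (z.1.1, z.2.1)])

lemma Ctx.marg (c : Ctx P X Y g M ε θ η b) (p : ℤ) :
    ∫ ω, |m1 (P.map (X 0)) g (X p ω) - m1 (P.map (X 0)) g (Y p ω)| ∂P ≤ 3 * θ := by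
  have hg := c.hg
  have hX := c.hX
  have hY := c.hY
  have : IsProbabilityMeasure (P.map (X 0)) := Measure.isProbabilityMeasure_map (by fun_prop)
  have hG : Measurable fun z : (ℝ × ℝ) × (ℝ × ℝ) => |g z.1.1 z.2.1 - g z.1.2 z.2.1| := by
    have h1 : Measurable fun z : (ℝ × ℝ) × (ℝ × ℝ) => g z.1.1 z.2.1 :=
      hg.comp (f := fun z : (ℝ × ℝ) × (ℝ × ℝ) => (z.1.1, z.2.1)) (by fun_prop)
    have h2 : Measurable fun z : (ℝ × ℝ) × (ℝ × ℝ) => g z.1.2 z.2.1 :=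
      hg.comp (f := fun z : (ℝ × ℝ) × (ℝ × ℝ) => (z.1.2, z.2.1)) (by fun_prop)
    exact (h1.sub h2).abs
  have key := c.master p 0 (fun z => |g z.1.1 z.2.1 - g z.1.2 z.2.1|) hG
    (fun z => abs_nonneg _) (fun z => c.gabs _ _ _ _) (by
      intro z h1 h2
      have := le_supVar c.g0 c.gM (ε := 2 * ε) (q := (z.1.1, z.2.1)) (r := (z.1.2, z.2.1)) (by
        have := c.hε
        rw [Metric.mem_closedBall, Prod.dist_eq, max_le_iff, Real.dist_eq, Real.dist_eq,
          abs_sub_comm]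
        constructor <;> simp <;> linarith)
      rw [abs_sub_comm]
      exact this.trans (by linarith [supVar_nonneg g (2 * ε) (z.1.1, z.2.1)]))
  have hG' : Measurable fun z : Ω × Ω => |g (X p z.1) (X 0 z.2) - g (Y p z.1) (X 0 z.2)| :=
    hG.comp (f := fun z : Ω × Ω => ((X p z.1, Y p z.1), (X 0 z.2, Y 0 z.2))) (by fun_prop)
  have hGi : Integrable (fun z : Ω × Ω => |g (X p z.1) (X 0 z.2) - g (Y p z.1) (X 0 z.2)|)
      (P.prod P) := integrable_bdd hG' (B := M) fun z => by rw [abs_abs]; exact c.gabs _ _ _ _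
  simp only at key
  rw [integral_prod _ hGi] at key
  refine le_trans (integral_mono ?_ hGi.integral_prod_left fun ω => ?_) key
  · have := m1_meas (P.map (X 0)) hg
    refine integrable_bdd (B := M) (by fun_prop) fun ω => ?_
    rw [abs_abs, abs_le]
    constructor <;> linarith [m1_nonneg (P.map (X 0)) c.g0 (X p ω),
      m1_nonneg (P.map (X 0)) c.g0 (Y p ω), m1_le (P.map (X 0)) hg c.g0 c.gM (X p ω),
      m1_le (P.map (X 0)) hg c.g0 c.gM (Y p ω)]
  · simp only
    have hs : ∀ x, Measurable (g x) := fun x => hg.comp (measurable_const.prodMk measurable_id)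
    have hs2 : Measurable (fun a => g (X p ω) a - g (Y p ω) a) := (hs _).sub (hs _)
    rw [m1, m1, ← integral_sub (g_sec_int _ hg c.g0 c.gM _) (g_sec_int _ hg c.g0 c.gM _),
      integral_map (hX 0).aemeasurable hs2.aestronglyMeasurable]
    exact abs_integral_le_integral_abs

lemma Ctx.dep_g (c : Ctx P X Y g M ε θ η b) (p q : ℤ) (hd : Decoup P (Y p) (Y q) b) :
    ∫ ω, |g (X p ω) (X q ω) - g (Y p ω) (Y q ω)| ∂P ≤ 9 * θ := by
  have hg := c.hg
  have hX := c.hX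
  have hY := c.hY
  have hM := c.M0
  -- joint law of approximations and values
  let ρ : Measure ((ℝ × ℝ) × (ℝ × ℝ)) := P.map (fun ω => ((Y p ω, Y q ω), (X p ω, X q ω)))
  have : IsProbabilityMeasure ρ := Measure.isProbabilityMeasure_map (by fun_prop)
  let good : Set ((ℝ × ℝ) × (ℝ × ℝ)) := {z | |z.2.1 - z.1.1| ≤ ε ∧ |z.2.2 - z.1.2| ≤ ε}
  have hgood : MeasurableSet good :=
    (measurableSet_le (f := fun z : (ℝ × ℝ) × (ℝ × ℝ) => |z.2.1 - z.1.1|)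
      (by fun_prop) measurable_const).inter
    (measurableSet_le (f := fun z : (ℝ × ℝ) × (ℝ × ℝ) => |z.2.2 - z.1.2|)
      (by fun_prop) measurable_const)
  let D : (ℝ × ℝ) × (ℝ × ℝ) → ℝ := fun z => |g z.2.1 z.2.2 - g z.1.1 z.1.2|
  have hD : Measurable D :=
    ((hg.comp measurable_snd).sub (hg.comp measurable_fst)).abs
  have hDM : ∀ z, D z ≤ M := fun z => c.gabs _ _ _ _
  let f : (ℝ × ℝ) × (ℝ × ℝ) → ℝ≥0∞ := fun z => ENNReal.ofReal (good.indicator D z)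
  have hindM : ∀ z, good.indicator D z ≤ M := fun z =>
    indicator_le' (fun z _ => hDM z) (fun _ _ => hM) z
  have hind0 : ∀ z, 0 ≤ good.indicator D z := fun z =>
    indicator_nonneg (fun z _ => abs_nonneg _) z
  have hf : Measurable f := (hD.indicator hgood).ennreal_ofReal
  let K : ℝ × ℝ → ℝ≥0∞ := fun u => ∫⁻ r, f (u, r) ∂(ρ.condKernel u)
  have hK : Measurable K := hf.lintegral_kernel_prod_right'
  have hKle : ∀ u s, (∀ r, good.indicator D (u, r) ≤ s) → K u ≤ ENNReal.ofReal s := by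
    intro u s hs
    calc K u ≤ ∫⁻ _, ENNReal.ofReal s ∂(ρ.condKernel u) :=
          lintegral_mono fun r => ENNReal.ofReal_le_ofReal (hs r)
      _ = ENNReal.ofReal s := by simp
  have hKM : ∀ u, K u ≤ ENNReal.ofReal M := fun u => hKle u M fun r => hindM _
  have hKr : ∀ u s, 0 ≤ s → (∀ r, good.indicator D (u, r) ≤ s) → (K u).toReal ≤ s :=
    fun u s h0 hs => ENNReal.toReal_le_of_le_ofReal h0 (hKle u s hs)
  have hKabs : ∀ u, |(K u).toReal| ≤ M := fun u => by
    rw [abs_of_nonneg ENNReal.toReal_nonneg]; exact hKr u M hM fun r => hindM _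
  -- the conditional mean integrates to the truncated difference
  have e1 : ∫ ω, (K (Y p ω, Y q ω)).toReal ∂P =
      ∫ ω, good.indicator D ((Y p ω, Y q ω), (X p ω, X q ω)) ∂P := by
    rw [integral_toReal (by fun_prop) (Eventually.of_forall fun ω =>
      (hKM _).trans_lt ENNReal.ofReal_lt_top),
      integral_eq_lintegral_of_nonneg_ae (Eventually.of_forall fun ω => hind0 _)
        ((hD.indicator hgood).comp (by fun_prop)).aestronglyMeasurable]
    congr 1
    have h1 : ∫⁻ z, f z ∂ρ = ∫⁻ ω, f ((Y p ω, Y q ω), (X p ω, X q ω)) ∂P :=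
      lintegral_map hf (by fun_prop)
    have h2 : ∫⁻ u, K u ∂ρ.fst = ∫⁻ z, f z ∂ρ := Measure.lintegral_condKernel hf
    have h3 : ρ.fst = P.map (fun ω => (Y p ω, Y q ω)) := by
      rw [Measure.fst, Measure.map_map measurable_fst (by fun_prop)]; rfl
    rw [h3, lintegral_map hK (by fun_prop)] at h2
    rw [h2, h1]
  have e2 := hd (fun u => (K u).toReal) hK.ennreal_toReal M hKabs
  have e3 := c.master p q (fun z => (K (z.1.2, z.2.2)).toReal) (by fun_prop)
    (fun z => ENNReal.toReal_nonneg) (fun z => hKr _ _ hM fun r => hindM _) (by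
      intro z h1 h2
      have hS := supVar_nonneg g (2 * ε) (z.1.1, z.2.1)
      refine hKr _ _ (by linarith) fun r => ?_
      by_cases hr : ((z.1.2, z.2.2), r) ∈ good
      · rw [indicator_of_mem hr]
        obtain ⟨hr1, hr2⟩ := hr
        simp only at hr1 hr2
        have hε := c.hε
        have a1 := le_supVar c.g0 c.gM (ε := 2 * ε) (q := (z.1.1, z.2.1)) (r := (z.1.2, z.2.2)) (by
          rw [Metric.mem_closedBall, Prod.dist_eq, max_le_iff, Real.dist_eq, Real.dist_eq,
            abs_sub_comm, abs_sub_comm z.2.2]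
          constructor <;> simp <;> linarith)
        have a2 := le_supVar c.g0 c.gM (ε := 2 * ε) (q := (z.1.1, z.2.1)) (r := r) (by
          rw [Metric.mem_closedBall, Prod.dist_eq, max_le_iff, Real.dist_eq, Real.dist_eq]
          constructor
          · have := abs_sub_le r.1 z.1.2 z.1.1
            rw [abs_sub_comm z.1.2] at this
            simp only; linarith
          · have := abs_sub_le r.2 z.2.2 z.2.1
            rw [abs_sub_comm z.2.2] at this
            simp only; linarith)
        have a3 := abs_sub_le (g r.1 r.2) (g z.1.1 z.2.1) (g z.1.2 z.2.2)
        rw [abs_sub_comm (g z.1.1 z.2.1)] at a3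
        simp only [D]
        simp only at a1 a2
        linarith
      · rw [indicator_of_notMem hr]
        linarith)
  simp only at e2 e3
  rw [e1] at e2
  -- the exceptional set
  let bp : Set Ω := {ω | ε < |X p ω - Y p ω|}
  let bq : Set Ω := {ω | ε < |X q ω - Y q ω|}
  have hbp : MeasurableSet bp := measurableSet_lt measurable_const (by fun_prop)
  have hbq : MeasurableSet bq := measurableSet_lt measurable_const (by fun_prop)
  have i1 : Integrable (fun ω => good.indicator D ((Y p ω, Y q ω), (X p ω, X q ω))) P :=
    integrable_bdd (B := M) ((hD.indicator hgood).comp (by fun_prop)) fun ω => by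
      rw [abs_of_nonneg (hind0 _)]; exact hindM _
  have i2 : Integrable (bp.indicator (fun _ => M)) P := (integrable_const M).indicator hbp
  have i3 : Integrable (bq.indicator (fun _ => M)) P := (integrable_const M).indicator hbq
  have hDi : Integrable (fun ω => |g (X p ω) (X q ω) - g (Y p ω) (Y q ω)|) P :=
    integrable_bdd (B := M) (hD.comp (f := fun ω => ((Y p ω, Y q ω), (X p ω, X q ω)))
      (by fun_prop)) fun ω => by rw [abs_abs]; exact c.gabs _ _ _ _
  have hle : ∫ ω, |g (X p ω) (X q ω) - g (Y p ω) (Y q ω)| ∂P ≤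
      ∫ ω, (good.indicator D ((Y p ω, Y q ω), (X p ω, X q ω)) + bp.indicator (fun _ => M) ω) +
        bq.indicator (fun _ => M) ω ∂P := by
    refine integral_mono hDi ((i1.add i2).add i3) fun ω => ?_
    simp only
    have p0 : 0 ≤ bp.indicator (fun _ => M) ω := indicator_nonneg (fun _ _ => hM) ω
    have q0 : 0 ≤ bq.indicator (fun _ => M) ω := indicator_nonneg (fun _ _ => hM) ω
    have n0 := hind0 ((Y p ω, Y q ω), (X p ω, X q ω))
    have hm := c.gabs (X p ω) (X q ω) (Y p ω) (Y q ω)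
    by_cases h1 : ω ∈ bp
    · have : bp.indicator (fun _ => M) ω = M := indicator_of_mem h1 _
      linarith
    by_cases h2 : ω ∈ bq
    · have : bq.indicator (fun _ => M) ω = M := indicator_of_mem h2 _
      linarith
    have h3 : ((Y p ω, Y q ω), (X p ω, X q ω)) ∈ good := ⟨not_lt.1 h1, not_lt.1 h2⟩
    have : good.indicator D ((Y p ω, Y q ω), (X p ω, X q ω)) = |g (X p ω) (X q ω) - g (Y p ω) (Y q ω)| :=
      indicator_of_mem h3 _
    linarith
  have i12 : Integrable (fun ω => good.indicator D ((Y p ω, Y q ω), (X p ω, X q ω)) +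
      bp.indicator (fun _ => M) ω) P := i1.add i2
  rw [integral_add i12 i3, integral_add i1 i2, integral_indicator_const _ hbp,
    integral_indicator_const _ hbq, smul_eq_mul, smul_eq_mul] at hle
  have b1 : P.real bp * M ≤ θ := by
    have := mul_le_mul_of_nonneg_right (c.mul_bad p) hM
    have h2 := c.hη
    rw [mul_comm] at h2
    exact this.trans h2
  have b2 : P.real bq * M ≤ θ := by
    have := mul_le_mul_of_nonneg_right (c.mul_bad q) hM
    have h2 := c.hη
    rw [mul_comm] at h2
    exact this.trans h2
  have b3 := c.hb
  have b4 := (abs_le.1 e2).2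
  linarith

end ctx

end UQuantile

namespace UQuantile

section quad
variable {Ω : Type*} [MeasurableSpace Ω] {P : Measure Ω} [IsProbabilityMeasure P]
  {X Y : ℤ → Ω → ℝ} {g : ℝ → ℝ → ℝ} {M ε θ η b : ℝ}

lemma HH_diff {E : Type*} [MeasurableSpace E] {ν : Measure E} [IsProbabilityMeasure ν]
    (μ : Measure ℝ) [IsProbabilityMeasure μ]
    (hg : Measurable (fun q : ℝ × ℝ => g q.1 q.2)) (g0 : ∀ x y, 0 ≤ g x y)
    (gM : ∀ x y, g x y ≤ M) {x y u v : E → ℝ} (hx : Measurable x) (hy : Measurable y)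
    (hu : Measurable u) (hv : Measurable v) {A B C : ℝ}
    (hA : ∫ e, |g (x e) (y e) - g (u e) (v e)| ∂ν ≤ A)
    (hB : ∫ e, |m1 μ g (x e) - m1 μ g (u e)| ∂ν ≤ B)
    (hC : ∫ e, |m1 μ g (y e) - m1 μ g (v e)| ∂ν ≤ C) :
    ∫ e, |HH μ g (x e) (y e) - HH μ g (u e) (v e)| ∂ν ≤ A + B + C := by
  have hm := m1_meas μ hg
  have hH := HH_meas μ hg
  have hgg : Measurable fun e => |g (x e) (y e) - g (u e) (v e)| :=
    ((hg.comp (hx.prodMk hy)).sub (hg.comp (hu.prodMk hv))).abs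
  have hHH : Measurable fun e => |HH μ g (x e) (y e) - HH μ g (u e) (v e)| :=
    ((hH.comp (hx.prodMk hy)).sub (hH.comp (hu.prodMk hv))).abs
  have i1 : Integrable (fun e => |g (x e) (y e) - g (u e) (v e)|) ν :=
    integrable_bdd (B := M) hgg fun e => by
      rw [abs_abs, abs_le]
      constructor <;> linarith [g0 (x e) (y e), g0 (u e) (v e), gM (x e) (y e), gM (u e) (v e)]
  have i2 : Integrable (fun e => |m1 μ g (x e) - m1 μ g (u e)|) ν :=
    integrable_bdd (B := M) (by fun_prop) fun e => by
      rw [abs_abs, abs_le]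
      constructor <;> linarith [m1_nonneg μ g0 (x e), m1_nonneg μ g0 (u e),
        m1_le μ hg g0 gM (x e), m1_le μ hg g0 gM (u e)]
  have i3 : Integrable (fun e => |m1 μ g (y e) - m1 μ g (v e)|) ν :=
    integrable_bdd (B := M) (by fun_prop) fun e => by
      rw [abs_abs, abs_le]
      constructor <;> linarith [m1_nonneg μ g0 (y e), m1_nonneg μ g0 (v e),
        m1_le μ hg g0 gM (y e), m1_le μ hg g0 gM (v e)]
  have i4 : Integrable (fun e => |HH μ g (x e) (y e) - HH μ g (u e) (v e)|) ν :=
    integrable_bdd (B := 4 * M) hHH fun e => by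
      have h1 := abs_le.1 (HH_abs μ hg g0 gM (x e) (y e))
      have h2 := abs_le.1 (HH_abs μ hg g0 gM (u e) (v e))
      rw [abs_abs, abs_le]
      constructor <;> linarith [h1.1, h1.2, h2.1, h2.2]
  have i12 : Integrable (fun e => |g (x e) (y e) - g (u e) (v e)| +
      |m1 μ g (x e) - m1 μ g (u e)|) ν := i1.add i2
  have key : ∫ e, |HH μ g (x e) (y e) - HH μ g (u e) (v e)| ∂ν ≤
      ∫ e, (|g (x e) (y e) - g (u e) (v e)| + |m1 μ g (x e) - m1 μ g (u e)|) +
        |m1 μ g (y e) - m1 μ g (v e)| ∂ν := by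
    refine integral_mono i4 (i12.add i3) fun e => ?_
    simp only [HH]
    have a1 := abs_le.1 (le_refl |g (x e) (y e) - g (u e) (v e)|)
    have a2 := abs_le.1 (le_refl |m1 μ g (x e) - m1 μ g (u e)|)
    have a3 := abs_le.1 (le_refl |m1 μ g (y e) - m1 μ g (v e)|)
    rw [abs_le]
    constructor <;> linarith [a1.1, a1.2, a2.1, a2.2, a3.1, a3.2]
  rw [integral_add i12 i3, integral_add i1 i2] at key
  linarith

lemma Ctx.HA (c : Ctx P X Y g M ε θ η b) (p q : ℤ) :
    ∫ z, |HH (P.map (X 0)) g (X p z.1) (X q z.2) - HH (P.map (X 0)) g (Y p z.1) (Y q z.2)|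
      ∂(P.prod P) ≤ 9 * θ := by
  have hX := c.hX
  have hY := c.hY
  have : IsProbabilityMeasure (P.map (X 0)) :=
    Measure.isProbabilityMeasure_map (hX 0).aemeasurable
  have h1 : ∫ z : Ω × Ω, |m1 (P.map (X 0)) g (X p z.1) - m1 (P.map (X 0)) g (Y p z.1)|
      ∂(P.prod P) ≤ 3 * θ := by
    have := integral_fun_fst (μ := P) (ν := P)
      (fun ω => |m1 (P.map (X 0)) g (X p ω) - m1 (P.map (X 0)) g (Y p ω)|)
    rw [this]; simpa using c.marg p
  have h2 : ∫ z : Ω × Ω, |m1 (P.map (X 0)) g (X q z.2) - m1 (P.map (X 0)) g (Y q z.2)|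
      ∂(P.prod P) ≤ 3 * θ := by
    have := integral_fun_snd (μ := P) (ν := P)
      (fun ω => |m1 (P.map (X 0)) g (X q ω) - m1 (P.map (X 0)) g (Y q ω)|)
    rw [this]; simpa using c.marg q
  have := HH_diff (P.map (X 0)) c.hg c.g0 c.gM (ν := P.prod P) (x := fun z => X p z.1)
    (y := fun z => X q z.2) (u := fun z => Y p z.1) (v := fun z => Y q z.2) (by fun_prop)
    (by fun_prop) (by fun_prop) (by fun_prop) (c.indep_g p q) h1 h2
  linarith

lemma Ctx.HC (c : Ctx P X Y g M ε θ η b) (p q : ℤ) (hd : Decoup P (Y p) (Y q) b) :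
    ∫ ω, |HH (P.map (X 0)) g (X p ω) (X q ω) - HH (P.map (X 0)) g (Y p ω) (Y q ω)| ∂P
      ≤ 15 * θ := by
  have hX := c.hX
  have hY := c.hY
  have : IsProbabilityMeasure (P.map (X 0)) :=
    Measure.isProbabilityMeasure_map (hX 0).aemeasurable
  have := HH_diff (P.map (X 0)) c.hg c.g0 c.gM (hX p) (hX q) (hY p) (hY q) (c.dep_g p q hd)
    (c.marg p) (c.marg q)
  linarith

lemma Ctx.lawX (c : Ctx P X Y g M ε θ η b) (p : ℤ) : P.map (X p) = P.map (X 0) := by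
  have hX := c.hX
  have hY := c.hY
  have := congrArg (fun ν => ν.map Prod.fst) (c.law p)
  rw [Measure.map_map measurable_fst (by fun_prop), Measure.map_map measurable_fst (by fun_prop)]
    at this
  exact this

lemma Ctx.quad (c : Ctx P X Y g M ε θ η b) (p q r s : ℤ) (hpq : Decoup P (Y p) (Y q) b)
    (hrs : Decoup P (Y r) (Y s) b)
    (hall : Decoup P (Y p) (fun ω => (Y q ω, Y r ω, Y s ω)) b) :
    |∫ ω, HH (P.map (X 0)) g (X p ω) (X q ω) * HH (P.map (X 0)) g (X r ω) (X s ω) ∂P|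
      ≤ 94 * M * θ := by
  have hX := c.hX
  have hY := c.hY
  have hM := c.M0
  have : IsProbabilityMeasure (P.map (X 0)) :=
    Measure.isProbabilityMeasure_map (hX 0).aemeasurable
  set H := HH (P.map (X 0)) g with hHdef
  have hH : Measurable (fun q : ℝ × ℝ => H q.1 q.2) := HH_meas _ c.hg
  have hHM : ∀ x y, |H x y| ≤ 2 * M := HH_abs _ c.hg c.g0 c.gM
  have hHc : ∀ {E : Type _} [MeasurableSpace E] {x y : E → ℝ}, Measurable x → Measurable y →
      Measurable fun e => H (x e) (y e) := fun hx hy => hH.comp (hx.prodMk hy)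
  have hprod : ∀ x y u v, |H x y * H u v| ≤ 4 * M * M := fun x y u v => by
    rw [abs_mul]
    have := mul_le_mul (hHM x y) (hHM u v) (abs_nonneg _) (by positivity)
    linarith
  have hprodm : ∀ x y u v d, |H x y * d - H u v * d| ≤ |d| * |H x y - H u v| := fun x y u v d => by
    rw [← sub_mul, abs_mul, mul_comm]
  -- replace by approximations
  have s1 : |∫ ω, H (X p ω) (X q ω) * H (X r ω) (X s ω) ∂P -
      ∫ ω, H (Y p ω) (Y q ω) * H (Y r ω) (Y s ω) ∂P| ≤ 60 * M * θ := by
    have mA := hHc (hX p) (hX q)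
    have mB := hHc (hX r) (hX s)
    have mA' := hHc (hY p) (hY q)
    have mB' := hHc (hY r) (hY s)
    have i1 : Integrable (fun ω => H (X p ω) (X q ω) * H (X r ω) (X s ω)) P :=
      integrable_bdd (mA.mul mB) fun ω => hprod _ _ _ _
    have i2 : Integrable (fun ω => H (Y p ω) (Y q ω) * H (Y r ω) (Y s ω)) P :=
      integrable_bdd (mA'.mul mB') fun ω => hprod _ _ _ _
    have i3 : Integrable (fun ω => |H (X p ω) (X q ω) - H (Y p ω) (Y q ω)|) P :=
      (Integrable.sub (integrable_bdd mA fun ω => hHM _ _) (integrable_bdd mA' fun ω => hHM _ _)).abs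
    have i4 : Integrable (fun ω => |H (X r ω) (X s ω) - H (Y r ω) (Y s ω)|) P :=
      (Integrable.sub (integrable_bdd mB fun ω => hHM _ _) (integrable_bdd mB' fun ω => hHM _ _)).abs
    rw [← integral_sub i1 i2]
    refine abs_integral_le_integral_abs.trans ?_
    have i12 : Integrable (fun ω => H (X p ω) (X q ω) * H (X r ω) (X s ω) -
      H (Y p ω) (Y q ω) * H (Y r ω) (Y s ω)) P := i1.sub i2
    have i34 : Integrable (fun ω => 2 * M * |H (X p ω) (X q ω) - H (Y p ω) (Y q ω)| +
      2 * M * |H (X r ω) (X s ω) - H (Y r ω) (Y s ω)|) P := (i3.const_mul _).add (i4.const_mul _)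
    refine (integral_mono i12.abs i34 fun ω => ?_).trans ?_
    · simp only
      have e : H (X p ω) (X q ω) * H (X r ω) (X s ω) - H (Y p ω) (Y q ω) * H (Y r ω) (Y s ω) =
        (H (X p ω) (X q ω) - H (Y p ω) (Y q ω)) * H (X r ω) (X s ω) +
        H (Y p ω) (Y q ω) * (H (X r ω) (X s ω) - H (Y r ω) (Y s ω)) := by ring
      rw [e]
      refine (abs_add_le _ _).trans ?_
      rw [abs_mul, abs_mul]
      have h1 := mul_le_mul_of_nonneg_left (hHM (X r ω) (X s ω))
        (abs_nonneg (H (X p ω) (X q ω) - H (Y p ω) (Y q ω)))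
      have h2 := mul_le_mul_of_nonneg_right (hHM (Y p ω) (Y q ω))
        (abs_nonneg (H (X r ω) (X s ω) - H (Y r ω) (Y s ω)))
      linarith
    · rw [integral_add (i3.const_mul _) (i4.const_mul _), integral_const_mul, integral_const_mul]
      have h1 := mul_le_mul_of_nonneg_left (c.HC p q hpq) (by positivity : 0 ≤ 2 * M)
      have h2 := mul_le_mul_of_nonneg_left (c.HC r s hrs) (by positivity : 0 ≤ 2 * M)
      linarith
  -- decouple
  have s2 := hall (fun z => H z.1 z.2.1 * H z.2.2.1 z.2.2.2)
    ((hH.comp (f := fun z : ℝ × ℝ × ℝ × ℝ => (z.1, z.2.1)) (by fun_prop)).mul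
      (hH.comp (f := fun z : ℝ × ℝ × ℝ × ℝ => (z.2.2.1, z.2.2.2)) (by fun_prop))) (4 * M * M)
    (fun z => hprod _ _ _ _)
  simp only at s2
  have s2' : 4 * (4 * M * M) * b ≤ 16 * M * θ := by
    have := mul_le_mul_of_nonneg_left c.hb (by positivity : 0 ≤ 16 * M)
    linarith
  -- replace back under the product law
  have mr : Measurable fun z : Ω × Ω => H (Y r z.2) (Y s z.2) := hHc (by fun_prop) (by fun_prop)
  have m5 : Measurable fun z : Ω × Ω => H (Y p z.1) (Y q z.2) := hHc (by fun_prop) (by fun_prop)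
  have m6 : Measurable fun z : Ω × Ω => H (X p z.1) (X q z.2) := hHc (by fun_prop) (by fun_prop)
  have i5 : Integrable (fun z : Ω × Ω => H (Y p z.1) (Y q z.2) * H (Y r z.2) (Y s z.2))
      (P.prod P) := integrable_bdd (m5.mul mr) fun ω => hprod _ _ _ _
  have i6 : Integrable (fun z : Ω × Ω => H (X p z.1) (X q z.2) * H (Y r z.2) (Y s z.2))
      (P.prod P) := integrable_bdd (m6.mul mr) fun ω => hprod _ _ _ _
  have i7 : Integrable (fun z : Ω × Ω => |H (X p z.1) (X q z.2) - H (Y p z.1) (Y q z.2)|)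
      (P.prod P) :=
    (Integrable.sub (integrable_bdd m6 fun ω => hHM _ _) (integrable_bdd m5 fun ω => hHM _ _)).abs
  have s3 : |∫ z, H (X p z.1) (X q z.2) * H (Y r z.2) (Y s z.2) ∂(P.prod P) -
      ∫ z, H (Y p z.1) (Y q z.2) * H (Y r z.2) (Y s z.2) ∂(P.prod P)| ≤ 18 * M * θ := by
    rw [← integral_sub i6 i5]
    refine abs_integral_le_integral_abs.trans ?_
    have i65 : Integrable (fun z : Ω × Ω => H (X p z.1) (X q z.2) * H (Y r z.2) (Y s z.2) -
      H (Y p z.1) (Y q z.2) * H (Y r z.2) (Y s z.2)) (P.prod P) := i6.sub i5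
    refine (integral_mono i65.abs (i7.const_mul (2 * M)) fun z => ?_).trans ?_
    · simp only
      refine (hprodm _ _ _ _ _).trans ?_
      exact mul_le_mul_of_nonneg_right (hHM _ _) (abs_nonneg _)
    · rw [integral_const_mul]
      have h1 := mul_le_mul_of_nonneg_left (c.HA p q) (by positivity : 0 ≤ 2 * M)
      linarith
  have s4 : ∫ z, H (X p z.1) (X q z.2) * H (Y r z.2) (Y s z.2) ∂(P.prod P) = 0 := by
    rw [integral_prod_symm _ i6]
    simp only
    have : ∀ y, ∫ x, H (X p x) y ∂P = 0 := fun y => by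
      have h1 := HH_degen (P.map (X 0)) c.hg c.g0 c.gM c.gs y
      rw [← c.lawX p, integral_map (hX p).aemeasurable, c.lawX p] at h1
      · exact h1
      · rw [c.lawX p]
        exact (hH.comp (f := fun x : ℝ => (x, y)) (by fun_prop)).aestronglyMeasurable
    simp [integral_mul_const, this]
  rw [s4] at s3
  have t1 := abs_le.1 s1
  have t2 := abs_le.1 s2
  have t3 := abs_le.1 s3
  rw [abs_le]
  constructor <;> linarith [t1.1, t1.2, t2.1, t2.2, t3.1, t3.2]

end quad

end UQuantile

namespace UQuantile

section inst
variable {Ω : Type*} [MeasurableSpace Ω] {P : Measure Ω} [IsProbabilityMeasure P]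
  {X Z : ℤ → Ω → ℝ}

/-- Finite window approximation of `X_i`. -/
def YY (f : (l : ℕ) → ((Fin (2 * l + 1) → ℝ) → ℝ)) (Z : ℤ → Ω → ℝ) (l : ℕ) (i : ℤ) (ω : Ω) : ℝ :=
  f l (fun j => Z (((j : ℕ) : ℤ) - (l : ℤ) + i) ω)

lemma YY_meas {f : (l : ℕ) → ((Fin (2 * l + 1) → ℝ) → ℝ)} (hf : ∀ l, Measurable (f l))
    (hZ : ∀ i, Measurable (Z i)) (l : ℕ) (i : ℤ) : Measurable (YY f Z l i) := by
  have := hf l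
  exact this.comp (measurable_pi_lambda _ fun j => hZ _)

lemma YY_decoup (hX : ∀ i, Measurable (X i)) (hZ : ∀ i, Measurable (Z i))
    (hst : IsPairStationary P X Z) {β : ℕ → ℝ} (hβ : IsBetaBound P Z β)
    {f : (l : ℕ) → ((Fin (2 * l + 1) → ℝ) → ℝ)} (hf : ∀ l, Measurable (f l)) (l : ℕ)
    {n m : ℕ} (c₁ : Fin n → ℤ) (c₂ : Fin m → ℤ) (c : ℤ) (h₁ : ∀ i, c₁ i + l ≤ c)
    (h₂ : ∀ j, c + l + l ≤ c₂ j) :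
    Decoup P (fun ω i => YY f Z l (c₁ i) ω) (fun ω j => YY f Z l (c₂ j) ω) (β l) := by
  have hfl := hf l
  have h : Decoup P (fun ω (i : Fin n × Fin (2 * l + 1)) => Z (((i.2 : ℕ) : ℤ) - (l : ℤ) + c₁ i.1) ω)
      (fun ω (i : Fin m × Fin (2 * l + 1)) => Z (((i.2 : ℕ) : ℤ) - (l : ℤ) + c₂ i.1) ω) (β l) := by
    intro F hF B hB
    refine beta_decouple hX hZ hst hβ
      (fun i : Fin n × Fin (2 * l + 1) => (((i.2 : ℕ) : ℤ) - (l : ℤ) + c₁ i.1))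
      (fun i : Fin m × Fin (2 * l + 1) => (((i.2 : ℕ) : ℤ) - (l : ℤ) + c₂ i.1)) c l ?_ ?_ F hF B hB
    · intro i
      have := h₁ i.1
      have := i.2.2
      omega
    · intro i
      have := h₂ i.1
      have := i.2.2
      omega
  exact h.comp (u := fun v i => f l (fun j => v (i, j))) (v := fun v i => f l (fun j => v (i, j)))
    (measurable_pi_lambda _ fun i => hfl.comp (by fun_prop))
    (measurable_pi_lambda _ fun i => hfl.comp (by fun_prop))

lemma YY_law (hX : ∀ i, Measurable (X i)) (hZ : ∀ i, Measurable (Z i))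
    (hst : IsPairStationary P X Z)
    {f : (l : ℕ) → ((Fin (2 * l + 1) → ℝ) → ℝ)} (hf : ∀ l, Measurable (f l)) (l : ℕ) (i : ℤ) :
    P.map (fun ω => (X i ω, YY f Z l i ω)) = P.map (fun ω => (X 0 ω, YY f Z l 0 ω)) := by
  have hfl := hf l
  have h := stat_fintype hX hZ hst (fun j : Fin (2 * l + 1) => ((j : ℕ) : ℤ) - (l : ℤ)) i
  let G : (Fin (2 * l + 1) → ℝ × ℝ) → ℝ × ℝ :=
    fun v => ((v ⟨l, by omega⟩).1, f l (fun j => (v j).2))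
  have hG : Measurable G := by
    refine Measurable.prodMk (by fun_prop) (hfl.comp (by fun_prop))
  have h' := congrArg (Measure.map G) h
  rw [Measure.map_map hG (by fun_prop), Measure.map_map hG (by fun_prop)] at h'
  simp only [Function.comp_def, G, sub_self, zero_add] at h'
  unfold YY
  simp only [add_zero]
  exact h'.symm

lemma ctx_exists (hX : ∀ i, Measurable (X i)) (hZ : ∀ i, Measurable (Z i))
    (hA : Assumption1 P X Z) {g : ℝ → ℝ → ℝ} {M : ℝ}
    (hg : Measurable (fun q : ℝ × ℝ => g q.1 q.2))
    (g0 : ∀ x y, 0 ≤ g x y) (gM : ∀ x y, g x y ≤ M) (gs : ∀ x y, g x y = g y x)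
    {L : ℝ} (hvar : ∀ ε > (0 : ℝ),
      ∫⁻ q, ENNReal.ofReal (supVar g ε q ^ 2) ∂((P.map (X 0)).prod (P.map (X 0))) ≤
      ENNReal.ofReal (L * ε)) :
    ∃ (f : (l : ℕ) → ((Fin (2 * l + 1) → ℝ) → ℝ)) (β : ℕ → ℝ) (K : ℝ) (l0 : ℕ),
      (∀ l, Measurable (f l)) ∧ IsBetaBound P Z β ∧ 0 ≤ K ∧ 1 ≤ l0 ∧ ∀ l, l0 ≤ l →
      ∃ ε η : ℝ, Ctx P X (YY f Z l) g M ε (K / (l : ℝ) ^ 2) η (β l) := by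
  obtain ⟨a, φ, -, -, -, ⟨f, hf, hfa⟩, hO⟩ := hA.pned
  obtain ⟨β, hβ0, hβ, hs⟩ := hA.mixing
  obtain ⟨Cβ, hCβ, hβ'⟩ := beta_rate hβ0 hβ hs
  obtain ⟨Cη, hCη⟩ := hO.bound
  obtain ⟨l1, hl1⟩ := eventually_atTop.1 hCη
  have hM : 0 ≤ M := (g0 0 0).trans (gM 0 0)
  refine ⟨f, _, (2 * max L 0 + 1) + M * max Cη 0 + M * Cβ, max l1 1, hf, hβ', by positivity,
    le_max_right _ _, fun l hl => ?_⟩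
  have hl1' := hl1 l (le_trans (le_max_left _ _) hl)
  have hlp : 1 ≤ l := le_trans (le_max_right _ _) hl
  have hlr : (1 : ℝ) ≤ l := by exact_mod_cast hlp
  have hl0 : (0 : ℝ) < l := by linarith
  have z6 : (l : ℝ) ^ (-6 : ℤ) = 1 / (l : ℝ) ^ 6 := by
    rw [zpow_neg, one_div]; norm_cast
  rw [z6] at hl1'
  have h26 : 1 / (l : ℝ) ^ 6 ≤ 1 / (l : ℝ) ^ 2 := by
    gcongr
    norm_num
  have h23 : 1 / (l : ℝ) ^ 3 ≤ 1 / (l : ℝ) ^ 2 := by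
    gcongr
    norm_num
  have h60 : 0 < 1 / (l : ℝ) ^ 6 := by positivity
  have h20 : 0 < 1 / (l : ℝ) ^ 2 := by positivity
  have hKe : ((2 * max L 0 + 1) + M * max Cη 0 + M * Cβ) / (l : ℝ) ^ 2 =
      (2 * max L 0 + 1) * (1 / (l : ℝ) ^ 2) + M * max Cη 0 * (1 / (l : ℝ) ^ 2)
        + M * Cβ * (1 / (l : ℝ) ^ 2) := by ring
  have p1 : 0 ≤ (2 * max L 0 + 1) * (1 / (l : ℝ) ^ 2) := by positivity
  have p2 : 0 ≤ M * max Cη 0 * (1 / (l : ℝ) ^ 2) := by positivity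
  have p3 : 0 ≤ M * Cβ * (1 / (l : ℝ) ^ 2) := by positivity
  refine ⟨1 / (l : ℝ) ^ 6, max Cη 0 * (1 / (l : ℝ) ^ 6), hX, fun i => YY_meas hf hZ l i, hg, g0, gM,
    gs, YY_law hX hZ hA.stationary hf l, ?_, ?_, ?_, ?_, h60⟩
  · have h1 := hfa l (1 / (l : ℝ) ^ 6) h60
    have h2 : a l * φ (1 / (l : ℝ) ^ 6) ≤ max Cη 0 * (1 / (l : ℝ) ^ 6) := by
      rw [Real.norm_eq_abs, Real.norm_of_nonneg h60.le] at hl1'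
      refine (le_abs_self _).trans (hl1'.trans ?_)
      exact mul_le_mul_of_nonneg_right (le_max_left _ _) h60.le
    refine le_trans (le_of_eq ?_) (h1.trans h2)
    simp only [YY, add_zero, Measure.real]
  · refine ⟨max L 0, 1 / (l : ℝ) ^ 3, by positivity, by positivity, ?_, ?_⟩
    · have : max L 0 * (2 * (1 / (l : ℝ) ^ 6)) / (1 / (l : ℝ) ^ 3) + 1 / (l : ℝ) ^ 3 =
          (2 * max L 0 + 1) * (1 / (l : ℝ) ^ 3) := by
        field_simp
      rw [this, hKe]
      have : (2 * max L 0 + 1) * (1 / (l : ℝ) ^ 3) ≤ (2 * max L 0 + 1) * (1 / (l : ℝ) ^ 2) := by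
        exact mul_le_mul_of_nonneg_left h23 (by positivity)
      linarith
    · refine (hvar _ (by positivity)).trans (ENNReal.ofReal_le_ofReal ?_)
      exact mul_le_mul_of_nonneg_right (le_max_left _ _) (by positivity)
  · rw [hKe]
    have : M * max Cη 0 * (1 / (l : ℝ) ^ 6) ≤ M * max Cη 0 * (1 / (l : ℝ) ^ 2) :=
      mul_le_mul_of_nonneg_left h26 (by positivity)
    linarith
  · have : l ≠ 0 := by omega
    rw [hKe]
    simp only [this, if_false, add_zero]
    have : M * (Cβ / (l : ℝ) ^ 2) = M * Cβ * (1 / (l : ℝ) ^ 2) := by ring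
    linarith

lemma iso (hX : ∀ i, Measurable (X i)) (hZ : ∀ i, Measurable (Z i))
    (hA : Assumption1 P X Z) {g : ℝ → ℝ → ℝ} {M : ℝ}
    (hg : Measurable (fun q : ℝ × ℝ => g q.1 q.2))
    (g0 : ∀ x y, 0 ≤ g x y) (gM : ∀ x y, g x y ≤ M) (gs : ∀ x y, g x y = g y x)
    {L : ℝ} (hvar : ∀ ε > (0 : ℝ),
      ∫⁻ q, ENNReal.ofReal (supVar g ε q ^ 2) ∂((P.map (X 0)).prod (P.map (X 0))) ≤
      ENNReal.ofReal (L * ε)) :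
    ∃ C : ℝ, 0 ≤ C ∧ ∀ (p q r s : ℤ) (k : ℕ),
      ((p + k ≤ q ∧ p + k ≤ r ∧ p + k ≤ s) ∨ (q + k ≤ p ∧ r + k ≤ p ∧ s + k ≤ p)) →
      (r + k ≤ s + (s - r) ∨ s + k ≤ r + (r - s)) →
      |∫ ω, HH (P.map (X 0)) g (X p ω) (X q ω) * HH (P.map (X 0)) g (X r ω) (X s ω) ∂P|
        ≤ C / ((k : ℝ) + 1) ^ 2 := by
  obtain ⟨f, β, K, l0, hf, hβ, hK, hl0, hctx⟩ := ctx_exists hX hZ hA hg g0 gM gs hvar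
  have hM : 0 ≤ M := (g0 0 0).trans (gM 0 0)
  have : IsProbabilityMeasure (P.map (X 0)) :=
    Measure.isProbabilityMeasure_map (hX 0).aemeasurable
  refine ⟨94 * M * K * 256 + 4 * M * M * (8 * l0) ^ 2, by positivity, ?_⟩
  intro p q r s k h1 h2
  have hk1 : (0 : ℝ) < (k : ℝ) + 1 := by positivity
  by_cases hk : k / 8 < l0
  · have hb : |∫ ω, HH (P.map (X 0)) g (X p ω) (X q ω) * HH (P.map (X 0)) g (X r ω) (X s ω) ∂P|
        ≤ 4 * M * M := by
      have := norm_integral_le_of_norm_le_const (μ := P) (C := 4 * M * M)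
        (f := fun ω => HH (P.map (X 0)) g (X p ω) (X q ω) * HH (P.map (X 0)) g (X r ω) (X s ω))
        (Eventually.of_forall fun ω => by
          rw [Real.norm_eq_abs, abs_mul]
          have := mul_le_mul (HH_abs (P.map (X 0)) hg g0 gM (X p ω) (X q ω))
            (HH_abs (P.map (X 0)) hg g0 gM (X r ω) (X s ω)) (abs_nonneg _) (by positivity)
          linarith)
      simpa using this
    refine hb.trans ?_
    rw [le_div_iff₀ (by positivity)]
    have h3 : (k : ℝ) + 1 ≤ 8 * l0 := by
      have : k + 1 ≤ 8 * l0 := by omega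
      exact_mod_cast this
    have h4 : ((k : ℝ) + 1) ^ 2 ≤ (8 * (l0 : ℝ)) ^ 2 := by gcongr
    have h5 := mul_le_mul_of_nonneg_left h4 (by positivity : 0 ≤ 4 * M * M)
    have h6 : 0 ≤ 94 * M * K * 256 := by positivity
    linarith
  · set l := k / 8 with hl
    have hlk : 8 * l ≤ k := by omega
    have hll : l0 ≤ l := by omega
    obtain ⟨ε, η, c⟩ := hctx l hll
    -- pairwise decoupling from distance
    have dec2 : ∀ u v : ℤ, (u + 3 * l ≤ v ∨ v + 3 * l ≤ u) →
        Decoup P (YY f Z l u) (YY f Z l v) (β l) := by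
      have aux : ∀ u v : ℤ, u + 3 * l ≤ v → Decoup P (YY f Z l u) (YY f Z l v) (β l) := by
        intro u v huv
        have := YY_decoup hX hZ hA.stationary hβ hf l (fun _ : Fin 1 => u) (fun _ : Fin 1 => v)
          (u + l) (fun _ => le_refl _) (fun _ => by omega)
        exact this.comp (u := fun w => w 0) (v := fun w => w 0) (by fun_prop) (by fun_prop)
      intro u v huv
      rcases huv with huv | huv
      · exact aux u v huv
      · exact (aux v u huv).symm
    have dec4 : Decoup P (YY f Z l p) (fun ω => (YY f Z l q ω, YY f Z l r ω, YY f Z l s ω)) (β l) := by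
      rcases h1 with h1 | h1
      · have := YY_decoup hX hZ hA.stationary hβ hf l (fun _ : Fin 1 => p) ![q, r, s]
          (p + l) (fun _ => le_refl _) (fun i => by fin_cases i <;> simp <;> omega)
        exact this.comp (u := fun w => w 0) (v := fun w => (w 0, w 1, w 2))
          (by fun_prop) (by fun_prop)
      · have := YY_decoup hX hZ hA.stationary hβ hf l ![q, r, s] (fun _ : Fin 1 => p)
          (p - l - l) (fun i => by fin_cases i <;> simp <;> omega) (fun i => by omega)
        exact (this.comp (u := fun w => (w 0, w 1, w 2)) (v := fun w => w 0)
          (by fun_prop) (by fun_prop)).symm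
    have key := c.quad p q r s (dec2 p q (by omega)) (dec2 r s (by omega)) dec4
    refine key.trans ?_
    have hlpos : (0 : ℝ) < l := by
      have : 0 < l := by omega
      exact_mod_cast this
    have h3 : (k : ℝ) + 1 ≤ 16 * l := by
      have : k + 1 ≤ 16 * l := by omega
      exact_mod_cast this
    have h4 : ((k : ℝ) + 1) ^ 2 ≤ (16 * (l : ℝ)) ^ 2 := by gcongr
    have h5 : 94 * M * (K / (l : ℝ) ^ 2) = 94 * M * K * 256 / (16 * (l : ℝ)) ^ 2 := by
      field_simp; norm_num
    rw [h5]
    calc 94 * M * K * 256 / (16 * (l : ℝ)) ^ 2 ≤ 94 * M * K * 256 / ((k : ℝ) + 1) ^ 2 := by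
          gcongr
      _ ≤ _ := by
          gcongr
          have : 0 ≤ 4 * M * M * (8 * (l0 : ℝ)) ^ 2 := by positivity
          linarith

end inst

end UQuantile

namespace UQuantile

/-- Reciprocal distance weight. -/
def kap (i j : ℕ) : ℝ := 1 / (1 + |(i : ℝ) - j|)

lemma kap_nonneg (i j : ℕ) : 0 ≤ kap i j := by unfold kap; positivity

lemma kap_comm (i j : ℕ) : kap i j = kap j i := by unfold kap; rw [abs_sub_comm]

lemma kap_of_le {i j : ℕ} (h : i ≤ j) : kap i j = 1 / (((j - i : ℕ) : ℝ) + 1) := by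
  unfold kap
  rw [abs_sub_comm, abs_of_nonneg (by have : (i : ℝ) ≤ j := by exact_mod_cast h
                                      linarith), Nat.cast_sub h, add_comm]

lemma geo_mean {e C x y : ℝ} (hC : 0 ≤ C) (hx : 0 < x) (hy : 0 < y)
    (h1 : e ≤ C / x ^ 2) (h2 : e ≤ C / y ^ 2) : e ≤ C * (1 / x * (1 / y)) := by
  rcases le_total x y with h | h
  · refine h2.trans ?_
    rw [div_eq_mul_inv]
    refine mul_le_mul_of_nonneg_left ?_ hC
    rw [← one_div, one_div_mul_one_div]
    apply one_div_le_one_div_of_le (by positivity)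
    nlinarith
  · refine h1.trans ?_
    rw [div_eq_mul_inv]
    refine mul_le_mul_of_nonneg_left ?_ hC
    rw [← one_div, one_div_mul_one_div]
    apply one_div_le_one_div_of_le (by positivity)
    nlinarith

lemma comb_aux {e : ℤ → ℤ → ℤ → ℤ → ℝ} {C : ℝ} (hC : 0 ≤ C)
    (s1 : ∀ p q r s, e p q r s = e q p r s) (s2 : ∀ p q r s, e p q r s = e r s p q)
    (he : ∀ (p q r s : ℤ) (k : ℕ),
      ((p + k ≤ q ∧ p + k ≤ r ∧ p + k ≤ s) ∨ (q + k ≤ p ∧ r + k ≤ p ∧ s + k ≤ p)) →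
      (r + k ≤ s + (s - r) ∨ s + k ≤ r + (r - s)) → e p q r s ≤ C / ((k : ℝ) + 1) ^ 2)
    (i j i' j' : ℕ) (hij : i < j) (hij' : i' < j') (h1 : j - i ≤ 2 * (j' - i'))
    (h2 : j' - i' ≤ 2 * (j - i)) (hii : i ≤ i') :
    e ((i : ℤ) + 1) ((j : ℤ) + 1) ((i' : ℤ) + 1) ((j' : ℤ) + 1) ≤
      C * (kap i j * kap i' j' + kap i i' * kap j j') := by
  have n1 := mul_nonneg hC (mul_nonneg (kap_nonneg i j) (kap_nonneg i' j'))
  have n2 := mul_nonneg hC (mul_nonneg (kap_nonneg i i') (kap_nonneg j j'))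
  rw [mul_add]
  by_cases hc : i' ≤ j
  · have a1 := he (i + 1) (j + 1) (i' + 1) (j' + 1) (i' - i) (by omega) (by omega)
    by_cases hj : j ≤ j'
    · have a2 := he (j' + 1) (i' + 1) (i + 1) (j + 1) (j' - j) (by omega) (by omega)
      rw [s1, s2] at a2
      have := geo_mean hC (by positivity) (by positivity) a1 a2
      rw [← kap_of_le hii, ← kap_of_le hj] at this
      linarith
    · have hj' : j' ≤ j := by omega
      have a2 := he (j + 1) (i + 1) (i' + 1) (j' + 1) (j - j') (by omega) (by omega)
      rw [s1] at a2
      have := geo_mean hC (by positivity) (by positivity) a1 a2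
      rw [← kap_of_le hii, ← kap_of_le hj', kap_comm j'] at this
      linarith
  · have a1 := he (i + 1) (j + 1) (i' + 1) (j' + 1) (j - i) (by omega) (by omega)
    have a2 := he (j' + 1) (i' + 1) (i + 1) (j + 1) (j' - i') (by omega) (by omega)
    rw [s1, s2] at a2
    have := geo_mean hC (by positivity) (by positivity) a1 a2
    rw [← kap_of_le hij.le, ← kap_of_le hij'.le] at this
    linarith

lemma comb {e : ℤ → ℤ → ℤ → ℤ → ℝ} {C : ℝ} (hC : 0 ≤ C)
    (s1 : ∀ p q r s, e p q r s = e q p r s) (s2 : ∀ p q r s, e p q r s = e r s p q)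
    (he : ∀ (p q r s : ℤ) (k : ℕ),
      ((p + k ≤ q ∧ p + k ≤ r ∧ p + k ≤ s) ∨ (q + k ≤ p ∧ r + k ≤ p ∧ s + k ≤ p)) →
      (r + k ≤ s + (s - r) ∨ s + k ≤ r + (r - s)) → e p q r s ≤ C / ((k : ℝ) + 1) ^ 2)
    (i j i' j' : ℕ) (hij : i < j) (hij' : i' < j') (h1 : j - i ≤ 2 * (j' - i'))
    (h2 : j' - i' ≤ 2 * (j - i)) :
    e ((i : ℤ) + 1) ((j : ℤ) + 1) ((i' : ℤ) + 1) ((j' : ℤ) + 1) ≤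
      C * (kap i j * kap i' j' + kap i i' * kap j j') := by
  rcases le_total i i' with h | h
  · exact comb_aux hC s1 s2 he i j i' j' hij hij' h1 h2 h
  · have := comb_aux hC s1 s2 he i' j' i j hij' hij h2 h1 h
    rw [s2, kap_comm i i', kap_comm j j', mul_comm (kap i j)]
    exact this

lemma kap_sum_row (N i : ℕ) (hi : i < N) :
    ∑ j ∈ Finset.range N, kap i j ≤ 2 * (1 + Real.log N) := by
  have hh : ∀ m, m ≤ N → ∑ d ∈ Finset.range m, 1 / ((d : ℝ) + 1) ≤ 1 + Real.log N := by
    intro m hm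
    have h1 := harmonic_le_one_add_log N
    have h2 : ((harmonic N : ℚ) : ℝ) = ∑ d ∈ Finset.range N, 1 / ((d : ℝ) + 1) := by
      simp [harmonic]
    rw [h2] at h1
    refine le_trans ?_ h1
    exact Finset.sum_le_sum_of_subset_of_nonneg (Finset.range_subset_range.2 hm)
      fun d _ _ => by positivity
  rw [← Finset.sum_range_add_sum_Ico _ hi.le]
  have e1 : ∑ j ∈ Finset.range i, kap i j ≤ 1 + Real.log N := by
    rw [← Finset.sum_range_reflect]
    refine le_trans (Finset.sum_le_sum fun j hj => ?_) (hh i hi.le)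
    rw [Finset.mem_range] at hj
    rw [kap_comm, kap_of_le (by omega)]
    apply one_div_le_one_div_of_le (by positivity)
    have : j ≤ i - (i - 1 - j) := by omega
    have : (j : ℝ) ≤ ((i - (i - 1 - j) : ℕ) : ℝ) := by exact_mod_cast this
    linarith
  have e2 : ∑ j ∈ Finset.Ico i N, kap i j ≤ 1 + Real.log N := by
    rw [Finset.sum_Ico_eq_sum_range]
    refine le_trans (Finset.sum_le_sum fun j hj => ?_) (hh (N - i) (by omega))
    rw [kap_of_le (by omega)]
    simp
  linarith

lemma kap_sum (L : ℕ) :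
    ∑ i ∈ Finset.range (2 ^ L), ∑ j ∈ Finset.range (2 ^ L), kap i j ≤ 2 ^ L * (2 * (1 + L)) := by
  have hl : Real.log ((2 ^ L : ℕ) : ℝ) ≤ L := by
    push_cast
    rw [Real.log_pow]
    have := Real.log_two_lt_d9
    have h0 : (0 : ℝ) ≤ L := by positivity
    nlinarith
  have : ∑ i ∈ Finset.range (2 ^ L), ∑ j ∈ Finset.range (2 ^ L), kap i j ≤
      ∑ i ∈ Finset.range (2 ^ L), (2 * (1 + L) : ℝ) := by
    refine Finset.sum_le_sum fun i hi => ?_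
    refine (kap_sum_row _ i (Finset.mem_range.1 hi)).trans ?_
    linarith
  simpa using this

lemma kap_sum4 (L : ℕ) {C : ℝ} (hC : 0 ≤ C) :
    ∑ j ∈ Finset.range (2 ^ L), ∑ j' ∈ Finset.range (2 ^ L),
      ∑ i ∈ Finset.range (2 ^ L), ∑ i' ∈ Finset.range (2 ^ L),
        C * (kap i j * kap i' j' + kap i i' * kap j j') ≤ 8 * C * (1 + L) ^ 2 * 4 ^ L := by
  set S := ∑ i ∈ Finset.range (2 ^ L), ∑ j ∈ Finset.range (2 ^ L), kap i j with hS
  have hS0 : 0 ≤ S := Finset.sum_nonneg fun i _ => Finset.sum_nonneg fun j _ => kap_nonneg i j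
  have hSle := kap_sum L
  have e1 : ∑ j ∈ Finset.range (2 ^ L), ∑ j' ∈ Finset.range (2 ^ L),
      ∑ i ∈ Finset.range (2 ^ L), ∑ i' ∈ Finset.range (2 ^ L), kap i j * kap i' j' = S * S := by
    have : S = ∑ j ∈ Finset.range (2 ^ L), ∑ i ∈ Finset.range (2 ^ L), kap i j := Finset.sum_comm
    rw [this, Finset.sum_mul_sum]
    refine Finset.sum_congr rfl fun j _ => Finset.sum_congr rfl fun j' _ => ?_
    rw [Finset.sum_mul_sum]
  have e2 : ∑ j ∈ Finset.range (2 ^ L), ∑ j' ∈ Finset.range (2 ^ L),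
      ∑ i ∈ Finset.range (2 ^ L), ∑ i' ∈ Finset.range (2 ^ L), kap i i' * kap j j' = S * S := by
    simp only [← Finset.sum_mul, ← Finset.mul_sum]
    rw [hS]
  have e3 : ∑ j ∈ Finset.range (2 ^ L), ∑ j' ∈ Finset.range (2 ^ L),
      ∑ i ∈ Finset.range (2 ^ L), ∑ i' ∈ Finset.range (2 ^ L),
        C * (kap i j * kap i' j' + kap i i' * kap j j') = C * (S * S) + C * (S * S) := by
    conv_rhs => rw [← e2]
    conv_rhs => enter [1]; rw [e2, ← e1]
    simp only [Finset.mul_sum, ← Finset.sum_add_distrib, mul_add]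
  rw [e3]
  have h1 : S * S ≤ (2 ^ L * (2 * (1 + L))) * (2 ^ L * (2 * (1 + L))) :=
    mul_self_le_mul_self hS0 hSle
  have h2 : ((2 : ℝ) ^ L * (2 * (1 + L))) * (2 ^ L * (2 * (1 + L))) = 4 * (1 + L) ^ 2 * 4 ^ L := by
    have : (4 : ℝ) ^ L = 2 ^ L * 2 ^ L := by rw [← mul_pow]; norm_num
    rw [this]; ring
  rw [h2] at h1
  have := mul_le_mul_of_nonneg_left h1 (by positivity : 0 ≤ 2 * C)
  linarith

end UQuantile

namespace UQuantile

/-- Dyadic square function on the block `[a, a + 2^L)`. -/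
def RR (D : ℕ → ℝ) : ℕ → ℕ → ℝ
  | 0, a => D a ^ 2
  | L + 1, a => (∑ j ∈ Finset.range (2 ^ (L + 1)), D (a + j)) ^ 2 + RR D L a + RR D L (a + 2 ^ L)

lemma RR_nonneg (D : ℕ → ℝ) (L a : ℕ) : 0 ≤ RR D L a := by
  induction L generalizing a with
  | zero => simp only [RR]; positivity
  | succ L ih =>
    simp only [RR]
    have := ih a
    have := ih (a + 2 ^ L)
    positivity

lemma RR_top (D : ℕ → ℝ) (L a : ℕ) : (∑ j ∈ Finset.range (2 ^ L), D (a + j)) ^ 2 ≤ RR D L a := by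
  cases L with
  | zero => simp [RR]
  | succ L =>
    simp only [RR]
    linarith [RR_nonneg D L a, RR_nonneg D L (a + 2 ^ L)]

lemma RR_max (D : ℕ → ℝ) (L a n : ℕ) (hn : n ≤ 2 ^ L) :
    (∑ j ∈ Finset.range n, D (a + j)) ^ 2 ≤ (L + 1) * RR D L a := by
  induction L generalizing a n with
  | zero =>
    have : n = 0 ∨ n = 1 := by simp at hn; omega
    rcases this with rfl | rfl
    · simp [RR]; positivity
    · simp [RR]
  | succ L ih =>
    have r1 := RR_nonneg D L a
    have r2 := RR_nonneg D L (a + 2 ^ L)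
    have hR : RR D (L + 1) a = (∑ j ∈ Finset.range (2 ^ (L + 1)), D (a + j)) ^ 2 + RR D L a +
      RR D L (a + 2 ^ L) := rfl
    have hsq := sq_nonneg (∑ j ∈ Finset.range (2 ^ (L + 1)), D (a + j))
    have hL : (0 : ℝ) ≤ L := by positivity
    push_cast
    by_cases h : n ≤ 2 ^ L
    · refine (ih a n h).trans ?_
      have : RR D L a ≤ RR D (L + 1) a := by linarith
      exact mul_le_mul (by linarith) this r1 (by positivity)
    · obtain ⟨m, rfl⟩ := Nat.exists_eq_add_of_le (not_le.1 h).le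
      have hm : m ≤ 2 ^ L := by rw [pow_succ] at hn; omega
      rw [Finset.sum_range_add]
      have hA := RR_top D L a
      have hB := ih (a + 2 ^ L) m hm
      simp only [add_assoc] at hB
      set A := ∑ j ∈ Finset.range (2 ^ L), D (a + j)
      set B := ∑ j ∈ Finset.range m, D (a + (2 ^ L + j))
      have h1 : (A + B) ^ 2 ≤ (L + 1 + 1) * (A ^ 2 + RR D L (a + 2 ^ L)) := by
        have h3 : (L + 1 : ℝ) * (A + B) ^ 2 ≤ (L + 1 + 1) * ((L + 1) * A ^ 2 + B ^ 2) := by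
          nlinarith [sq_nonneg ((L + 1 : ℝ) * A - B)]
        have h4 : (L + 1 : ℝ) * (A + B) ^ 2 ≤ (L + 1) * ((L + 1 + 1) * (A ^ 2 + RR D L (a + 2 ^ L))) := by
          have := mul_le_mul_of_nonneg_left hB (by positivity : (0 : ℝ) ≤ L + 1 + 1)
          linarith
        exact le_of_mul_le_mul_left h4 (by positivity)
      refine h1.trans (mul_le_mul_of_nonneg_left ?_ (by positivity))
      linarith

section prob
variable {Ω : Type*} [MeasurableSpace Ω] {P : Measure Ω} [IsProbabilityMeasure P]

lemma sq_sum_int {D : ℕ → Ω → ℝ} (hD : ∀ j j', Integrable (fun ω => D j ω * D j' ω) P) (a n : ℕ) :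
    Integrable (fun ω => (∑ j ∈ Finset.range n, D (a + j) ω) ^ 2) P := by
  simp only [sq, Finset.sum_mul_sum]
  exact integrable_finsetSum _ fun j _ => integrable_finsetSum _ fun j' _ => hD _ _

lemma RR_int {D : ℕ → Ω → ℝ} (hD : ∀ j j', Integrable (fun ω => D j ω * D j' ω) P) (L a : ℕ) :
    Integrable (fun ω => RR (fun j => D j ω) L a) P := by
  induction L generalizing a with
  | zero => simp only [RR, sq]; exact hD a a
  | succ L ih => simp only [RR]; exact ((sq_sum_int hD a _).add (ih a)).add (ih _)

/-- Sum of absolute mixed moments over a block. -/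
def TT (P : Measure Ω) (D : ℕ → Ω → ℝ) (a n : ℕ) : ℝ :=
  ∑ j ∈ Finset.range n, ∑ j' ∈ Finset.range n, |∫ ω, D (a + j) ω * D (a + j') ω ∂P|

lemma sq_sum_le {D : ℕ → Ω → ℝ} (hD : ∀ j j', Integrable (fun ω => D j ω * D j' ω) P) (a n : ℕ) :
    ∫ ω, (∑ j ∈ Finset.range n, D (a + j) ω) ^ 2 ∂P ≤ TT P D a n := by
  simp only [sq, Finset.sum_mul_sum]
  rw [integral_finsetSum _ fun j _ => integrable_finsetSum _ fun j' _ => hD _ _]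
  refine Finset.sum_le_sum fun j _ => ?_
  rw [integral_finsetSum _ fun j' _ => hD _ _]
  exact Finset.sum_le_sum fun j' _ => le_abs_self _

lemma TT_split (D : ℕ → Ω → ℝ) (a n m : ℕ) : TT P D a n + TT P D (a + n) m ≤ TT P D a (n + m) := by
  unfold TT
  rw [Finset.sum_range_add (n := n) (m := m)]
  refine add_le_add (Finset.sum_le_sum fun j _ => ?_) (Finset.sum_le_sum fun j _ => ?_)
  · exact Finset.sum_le_sum_of_subset_of_nonneg (Finset.range_subset_range.2 (by omega))
      fun _ _ _ => abs_nonneg _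
  · rw [Finset.sum_range_add (n := n) (m := m)]
    simp only [add_assoc]
    exact le_add_of_nonneg_left (Finset.sum_nonneg fun _ _ => abs_nonneg _)

lemma RR_exp {D : ℕ → Ω → ℝ} (hD : ∀ j j', Integrable (fun ω => D j ω * D j' ω) P) (L a : ℕ) :
    ∫ ω, RR (fun j => D j ω) L a ∂P ≤ (L + 1) * TT P D a (2 ^ L) := by
  induction L generalizing a with
  | zero =>
    have := sq_sum_le hD a 1
    simpa [RR] using this
  | succ L ih =>
    simp only [RR]
    have i1 := sq_sum_int hD a (2 ^ (L + 1))
    have i2 := RR_int hD L a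
    have i3 := RR_int hD L (a + 2 ^ L)
    have i12 : Integrable (fun ω => (∑ j ∈ Finset.range (2 ^ (L + 1)), D (a + j) ω) ^ 2 +
      RR (fun j => D j ω) L a) P := i1.add i2
    rw [integral_add i12 i3, integral_add i1 i2]
    have h1 := sq_sum_le hD a (2 ^ (L + 1))
    have h2 := ih a
    have h3 := ih (a + 2 ^ L)
    have h4 := TT_split (P := P) D a (2 ^ L) (2 ^ L)
    have h5 : 2 ^ L + 2 ^ L = 2 ^ (L + 1) := by ring
    rw [h5] at h4
    have h6 := mul_le_mul_of_nonneg_left h4 (by positivity : (0 : ℝ) ≤ L + 1)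
    push_cast
    linarith

/-- The part of the `j`-th row with gap of dyadic size `s`. -/
def DD (w : ℕ → ℕ → Ω → ℝ) (s j : ℕ) (ω : Ω) : ℝ :=
  ∑ i ∈ (Finset.range j).filter (fun i => Nat.log 2 (j - i) = s), w i j ω

lemma row_eq (w : ℕ → ℕ → Ω → ℝ) (L j : ℕ) (hj : j < 2 ^ L) (ω : Ω) :
    ∑ i ∈ Finset.range j, w i j ω = ∑ s ∈ Finset.range L, DD w s j ω := by
  unfold DD
  rw [Finset.sum_fiberwise_of_maps_to]
  intro i hi
  rw [Finset.mem_range] at hi ⊢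
  exact Nat.log_lt_of_lt_pow (by omega) (by omega)

lemma DD_exp {w : ℕ → ℕ → Ω → ℝ}
    (hw : ∀ i j i' j', Integrable (fun ω => w i j ω * w i' j' ω) P) {C : ℝ} (hC : 0 ≤ C)
    (hc : ∀ i j i' j' : ℕ, i < j → i' < j' → j - i ≤ 2 * (j' - i') → j' - i' ≤ 2 * (j - i) →
      |∫ ω, w i j ω * w i' j' ω ∂P| ≤ C * (kap i j * kap i' j' + kap i i' * kap j j'))
    (s L : ℕ) : TT P (DD w s) 0 (2 ^ L) ≤ 8 * C * (1 + L) ^ 2 * 4 ^ L := by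
  refine le_trans ?_ (kap_sum4 L hC)
  unfold TT
  refine Finset.sum_le_sum fun j hj => Finset.sum_le_sum fun j' hj' => ?_
  rw [Finset.mem_range] at hj hj'
  simp only [zero_add]
  have hn : ∀ i i', 0 ≤ C * (kap i j * kap i' j' + kap i i' * kap j j') := fun i i' =>
    mul_nonneg hC (add_nonneg (mul_nonneg (kap_nonneg _ _) (kap_nonneg _ _))
      (mul_nonneg (kap_nonneg _ _) (kap_nonneg _ _)))
  simp only [DD, Finset.sum_mul_sum]
  rw [integral_finsetSum _ fun j _ => integrable_finsetSum _ fun j' _ => hw _ _ _ _]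
  refine (Finset.abs_sum_le_sum_abs _ _).trans ?_
  refine le_trans (Finset.sum_le_sum fun i hi => ?_)
    (Finset.sum_le_sum_of_subset_of_nonneg (s := (Finset.range j).filter
      (fun i => Nat.log 2 (j - i) = s)) ?_ fun i _ _ => Finset.sum_nonneg fun i' _ => hn i i')
  · rw [integral_finsetSum _ fun j' _ => hw _ _ _ _]
    refine (Finset.abs_sum_le_sum_abs _ _).trans ?_
    refine le_trans (Finset.sum_le_sum fun i' hi' => ?_)
      (Finset.sum_le_sum_of_subset_of_nonneg (s := (Finset.range j').filter
        (fun i => Nat.log 2 (j' - i) = s)) ?_ fun i' _ _ => hn i i')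
    · rw [Finset.mem_filter, Finset.mem_range] at hi hi'
      have a1 := Nat.lt_pow_succ_log_self (b := 2) (by norm_num) (j - i)
      have a2 := Nat.pow_log_le_self 2 (x := j - i) (by omega)
      have a3 := Nat.lt_pow_succ_log_self (b := 2) (by norm_num) (j' - i')
      have a4 := Nat.pow_log_le_self 2 (x := j' - i') (by omega)
      rw [hi.2, Nat.succ_eq_add_one, pow_succ] at a1
      rw [hi'.2, Nat.succ_eq_add_one, pow_succ] at a3
      rw [hi.2] at a2
      rw [hi'.2] at a4
      exact hc i j i' j' hi.1 hi'.1 (by omega) (by omega)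
    · intro i'
      simp only [Finset.mem_filter, Finset.mem_range]
      omega
  · intro i
    simp only [Finset.mem_filter, Finset.mem_range]
    omega

/-- Majorant of the squared partial sums up to `2^L`. -/
def VV (w : ℕ → ℕ → Ω → ℝ) (L : ℕ) (ω : Ω) : ℝ :=
  L * ((L + 1) * ∑ s ∈ Finset.range L, RR (fun j => DD w s j ω) L 0)

lemma VV_nonneg (w : ℕ → ℕ → Ω → ℝ) (L : ℕ) (ω : Ω) : 0 ≤ VV w L ω := by
  unfold VV
  have : 0 ≤ ∑ s ∈ Finset.range L, RR (fun j => DD w s j ω) L 0 :=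
    Finset.sum_nonneg fun s _ => RR_nonneg _ _ _
  positivity

lemma Q_le (w : ℕ → ℕ → Ω → ℝ) (L n : ℕ) (hn : n ≤ 2 ^ L) (ω : Ω) :
    (∑ j ∈ Finset.range n, ∑ i ∈ Finset.range j, w i j ω) ^ 2 ≤ VV w L ω := by
  have h1 : ∑ j ∈ Finset.range n, ∑ i ∈ Finset.range j, w i j ω =
      ∑ s ∈ Finset.range L, ∑ j ∈ Finset.range n, DD w s j ω := by
    rw [Finset.sum_comm]
    refine Finset.sum_congr rfl fun j hj => row_eq w L j ?_ ω
    rw [Finset.mem_range] at hj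
    omega
  rw [h1]
  refine sq_sum_le_card_mul_sum_sq.trans ?_
  rw [Finset.card_range, VV]
  refine mul_le_mul_of_nonneg_left ?_ (by positivity)
  rw [Finset.mul_sum]
  refine Finset.sum_le_sum fun s _ => ?_
  have := RR_max (fun j => DD w s j ω) L 0 n hn
  simpa using this

lemma DD_int {w : ℕ → ℕ → Ω → ℝ}
    (hw : ∀ i j i' j', Integrable (fun ω => w i j ω * w i' j' ω) P) (s j j' : ℕ) :
    Integrable (fun ω => DD w s j ω * DD w s j' ω) P := by
  simp only [DD, Finset.sum_mul_sum]
  exact integrable_finsetSum _ fun j _ => integrable_finsetSum _ fun j' _ => hw _ _ _ _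

lemma VV_int {w : ℕ → ℕ → Ω → ℝ}
    (hw : ∀ i j i' j', Integrable (fun ω => w i j ω * w i' j' ω) P) (L : ℕ) :
    Integrable (VV w L) P := by
  unfold VV
  exact ((integrable_finsetSum _ fun s _ => RR_int (DD_int hw s) L 0).const_mul _).const_mul _

lemma VV_exp {w : ℕ → ℕ → Ω → ℝ}
    (hw : ∀ i j i' j', Integrable (fun ω => w i j ω * w i' j' ω) P) {C : ℝ} (hC : 0 ≤ C)
    (hc : ∀ i j i' j' : ℕ, i < j → i' < j' → j - i ≤ 2 * (j' - i') → j' - i' ≤ 2 * (j - i) →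
      |∫ ω, w i j ω * w i' j' ω ∂P| ≤ C * (kap i j * kap i' j' + kap i i' * kap j j'))
    (L : ℕ) : ∫ ω, VV w L ω ∂P ≤ 8 * C * ((L + 1 : ℕ) : ℝ) ^ 6 * 4 ^ L := by
  unfold VV
  rw [integral_const_mul, integral_const_mul,
    integral_finsetSum _ fun s _ => RR_int (DD_int hw s) L 0]
  have h1 : ∑ s ∈ Finset.range L, ∫ ω, RR (fun j => DD w s j ω) L 0 ∂P ≤
      ∑ s ∈ Finset.range L, ((L : ℝ) + 1) * (8 * C * (1 + L) ^ 2 * 4 ^ L) := by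
    refine Finset.sum_le_sum fun s _ => (RR_exp (DD_int hw s) L 0).trans ?_
    exact mul_le_mul_of_nonneg_left (DD_exp hw hC hc s L) (by positivity)
  rw [Finset.sum_const, Finset.card_range, nsmul_eq_mul] at h1
  calc (L : ℝ) * ((L + 1) * ∑ s ∈ Finset.range L, ∫ ω, RR (fun j => DD w s j ω) L 0 ∂P)
      ≤ (L : ℝ) * ((L + 1) * (L * (((L : ℝ) + 1) * (8 * C * (1 + L) ^ 2 * 4 ^ L)))) := by
        gcongr
    _ ≤ (L + 1 : ℝ) * ((L + 1) * ((L + 1) * (((L : ℝ) + 1) * (8 * C * (1 + L) ^ 2 * 4 ^ L)))) := by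
        gcongr <;> linarith
    _ = _ := by push_cast; ring

lemma VV_as {w : ℕ → ℕ → Ω → ℝ}
    (hw : ∀ i j i' j', Integrable (fun ω => w i j ω * w i' j' ω) P) {C : ℝ} (hC : 0 ≤ C)
    (hc : ∀ i j i' j' : ℕ, i < j → i' < j' → j - i ≤ 2 * (j' - i') → j' - i' ≤ 2 * (j - i) →
      |∫ ω, w i j ω * w i' j' ω ∂P| ≤ C * (kap i j * kap i' j' + kap i i' * kap j j'))
    {r : ℝ} (hr : 4 < r) :
    ∀ᵐ ω ∂P, ∃ K : ℝ, 0 ≤ K ∧ ∀ L, VV w L ω ≤ K * r ^ L := by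
  have hr0 : 0 < r := by linarith
  have hsum : Summable fun L : ℕ => 8 * C * ((L + 1 : ℕ) : ℝ) ^ 6 * 4 ^ L / r ^ L := by
    have h1 : Summable fun L : ℕ => ((L : ℝ) ^ 6 * (4 / r) ^ L : ℝ) :=
      summable_pow_mul_geometric_of_norm_lt_one 6 (by
        rw [Real.norm_of_nonneg (by positivity), div_lt_one hr0]; exact hr)
    have h2 := ((summable_nat_add_iff 1).2 h1).mul_left (8 * C * (r / 4))
    refine h2.congr fun L => ?_
    rw [div_pow, pow_succ 4, pow_succ r]
    field_simp
  have hmeas : ∀ L, AEMeasurable (fun ω => ENNReal.ofReal (VV w L ω / r ^ L)) P := fun L =>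
    ((VV_int hw L).aestronglyMeasurable.aemeasurable.div_const _).ennreal_ofReal
  have hfin : ∫⁻ ω, ∑' L, ENNReal.ofReal (VV w L ω / r ^ L) ∂P ≠ ⊤ := by
    rw [lintegral_tsum hmeas]
    refine ne_top_of_le_ne_top hsum.tsum_ofReal_ne_top (ENNReal.tsum_le_tsum fun L => ?_)
    rw [← ofReal_integral_eq_lintegral_ofReal ((VV_int hw L).div_const _)
      (Eventually.of_forall fun ω => div_nonneg (VV_nonneg w L ω) (by positivity))]
    refine ENNReal.ofReal_le_ofReal ?_
    rw [integral_div]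
    exact div_le_div_of_nonneg_right (VV_exp hw hC hc L) (by positivity)
  have := ae_lt_top' (AEMeasurable.tsum hmeas) hfin
  filter_upwards [this] with ω hω
  refine ⟨(∑' L, ENNReal.ofReal (VV w L ω / r ^ L)).toReal, ENNReal.toReal_nonneg, fun L => ?_⟩
  · rw [← div_le_iff₀ (by positivity)]
    exact (ENNReal.ofReal_le_iff_le_toReal hω.ne).1
      (ENNReal.le_tsum (f := fun L => ENNReal.ofReal (VV w L ω / r ^ L)) L)

lemma Q_as {w : ℕ → ℕ → Ω → ℝ}
    (hw : ∀ i j i' j', Integrable (fun ω => w i j ω * w i' j' ω) P) {C : ℝ} (hC : 0 ≤ C)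
    (hc : ∀ i j i' j' : ℕ, i < j → i' < j' → j - i ≤ 2 * (j' - i') → j' - i' ≤ 2 * (j - i) →
      |∫ ω, w i j ω * w i' j' ω ∂P| ≤ C * (kap i j * kap i' j' + kap i i' * kap j j')) :
    ∀ᵐ ω ∂P, ∃ K : ℝ, ∀ᶠ n : ℕ in atTop,
      |∑ j ∈ Finset.range n, ∑ i ∈ Finset.range j, w i j ω| ≤
        K * (n : ℝ) ^ ((5 : ℝ) / 4) * Real.log n ^ 2 := by
  have hr : (4 : ℝ) < 2 ^ ((5 : ℝ) / 2) := by
    have : (4 : ℝ) = 2 ^ (2 : ℝ) := by norm_num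
    rw [this]
    exact Real.rpow_lt_rpow_of_exponent_lt (by norm_num) (by norm_num)
  filter_upwards [VV_as hw hC hc hr] with ω hω
  obtain ⟨K, hK, hV⟩ := hω
  refine ⟨Real.sqrt K * 2 ^ ((5 : ℝ) / 4), ?_⟩
  filter_upwards [eventually_ge_atTop 3] with n hn
  have hn0 : (0 : ℝ) ≤ n := by positivity
  set L := Nat.log 2 n + 1 with hL
  have h1 : n ≤ 2 ^ L := (Nat.lt_pow_succ_log_self (by norm_num) n).le
  have h2 : 2 ^ L ≤ 2 * n := by
    have := Nat.pow_log_le_self 2 (x := n) (by omega)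
    rw [hL, pow_succ]; omega
  have h2' : (2 : ℝ) ^ L ≤ 2 * n := by exact_mod_cast h2
  have h3 := (Q_le w L n h1 ω).trans (hV L)
  have h4 : ((2 : ℝ) ^ ((5 : ℝ) / 2)) ^ L ≤ (2 * (n : ℝ)) ^ ((5 : ℝ) / 2) := by
    rw [← Real.rpow_natCast, ← Real.rpow_mul (by norm_num), mul_comm,
      Real.rpow_mul (by norm_num), Real.rpow_natCast]
    exact Real.rpow_le_rpow (by positivity) h2' (by norm_num)
  have h5 : (2 * (n : ℝ)) ^ ((5 : ℝ) / 2) = ((2 * (n : ℝ)) ^ ((5 : ℝ) / 4)) ^ 2 := by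
    rw [← Real.rpow_natCast, ← Real.rpow_mul (by positivity)]; norm_num
  rw [h5] at h4
  have h6 : (∑ j ∈ Finset.range n, ∑ i ∈ Finset.range j, w i j ω) ^ 2 ≤
      (Real.sqrt K * (2 * (n : ℝ)) ^ ((5 : ℝ) / 4)) ^ 2 := by
    rw [mul_pow, Real.sq_sqrt hK]
    exact h3.trans (mul_le_mul_of_nonneg_left h4 hK)
  have h7 := abs_le_of_sq_le_sq h6 (by positivity)
  have h8 : 1 ≤ Real.log n := by
    rw [Real.le_log_iff_exp_le (by positivity)]
    have := Real.exp_one_lt_d9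
    have : (3 : ℝ) ≤ n := by exact_mod_cast hn
    linarith
  have h9 : 1 ≤ Real.log n ^ 2 := one_le_pow₀ h8
  rw [Real.mul_rpow (by norm_num) hn0] at h7
  have h10 : |∑ j ∈ Finset.range n, ∑ i ∈ Finset.range j, w i j ω| ≤
      Real.sqrt K * (2 ^ ((5 : ℝ) / 4) * (n : ℝ) ^ ((5 : ℝ) / 4)) := h7
  refine h10.trans ?_
  rw [← mul_assoc]
  exact le_mul_of_one_le_right (by positivity) h9

end prob

/-- Reindexing the double sum. -/
lemma sum_reindex (W : ℤ → ℤ → ℝ) (n : ℕ) :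
    ∑ i ∈ Finset.Icc (1 : ℤ) (n : ℤ), ∑ j ∈ Finset.Ioc i (n : ℤ), W i j =
      ∑ j ∈ Finset.range n, ∑ i ∈ Finset.range j, W ((i : ℤ) + 1) ((j : ℤ) + 1) := by
  rw [Finset.sum_sigma', Finset.sum_sigma']
  refine Finset.sum_bij' (fun x _ => ⟨(x.2 - 1).toNat, (x.1 - 1).toNat⟩)
    (fun y _ => ⟨(y.2 : ℤ) + 1, (y.1 : ℤ) + 1⟩) ?_ ?_ ?_ ?_ ?_
  · rintro ⟨i, j⟩ h
    simp only [Finset.mem_sigma, Finset.mem_Icc, Finset.mem_Ioc, Finset.mem_range] at h ⊢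
    omega
  · rintro ⟨j, i⟩ h
    simp only [Finset.mem_sigma, Finset.mem_Icc, Finset.mem_Ioc, Finset.mem_range] at h ⊢
    omega
  · rintro ⟨i, j⟩ h
    simp only [Finset.mem_sigma, Finset.mem_Icc, Finset.mem_Ioc] at h
    simp only [Sigma.mk.injEq, heq_eq_eq]
    omega
  · rintro ⟨j, i⟩ h
    simp
  · rintro ⟨i, j⟩ h
    simp only [Finset.mem_sigma, Finset.mem_Icc, Finset.mem_Ioc] at h
    simp only
    congr 1 <;> omega

end UQuantile

namespace UQuantile

/-- (Lemma A.3, almost-sure bound.) Under Assumption 1, for any `t` at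
which the variation condition holds,
`Σ_{1 ≤ i < j ≤ n} h₂(X_i, X_j, t) = O(n^{5/4} log² n)` almost surely. -/
theorem h2_as_bound
    {Ω : Type*} [MeasurableSpace Ω] (P : Measure Ω) [IsProbabilityMeasure P]
    (X Z : ℤ → Ω → ℝ) (hX : ∀ i, Measurable (X i)) (hZ : ∀ i, Measurable (Z i))
    (h : ℝ → ℝ → ℝ → ℝ) (hker : IsUQKernel h)
    (hA1 : Assumption1 P X Z)
    (t : ℝ) (hvar : ∃ L : ℝ, VariationAt (P.map (X 0)) h L t) :
    ∀ᵐ ω ∂P, ∃ C : ℝ, ∀ᶠ n : ℕ in atTop,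
      |∑ i ∈ Finset.Icc (1 : ℤ) (n : ℤ), ∑ j ∈ Finset.Ioc i (n : ℤ),
          h2 (P.map (X 0)) h (X i ω) (X j ω) t| ≤
        C * (n : ℝ) ^ ((5 : ℝ) / 4) * Real.log n ^ 2 := by
  obtain ⟨M, gM'⟩ := hker.bounded
  obtain ⟨L, hL⟩ := hvar
  have hprob : IsProbabilityMeasure (P.map (X 0)) :=
    Measure.isProbabilityMeasure_map (hX 0).aemeasurable
  let g : ℝ → ℝ → ℝ := fun x y => h x y t
  have hg : Measurable (fun q : ℝ × ℝ => g q.1 q.2) :=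
    hker.measurable.comp (f := fun q : ℝ × ℝ => (q.1, q.2, t)) (by fun_prop)
  have g0 : ∀ x y, 0 ≤ g x y := fun x y => hker.nonneg x y t
  have gM : ∀ x y, g x y ≤ M := fun x y => gM' x y t
  have gs : ∀ x y, g x y = g y x := fun x y => hker.symm x y t
  have hM : 0 ≤ M := (g0 0 0).trans (gM 0 0)
  obtain ⟨C, hC, hiso⟩ := iso hX hZ hA1 hg g0 gM gs (L := L) hL
  have hh2 : ∀ x y, h2 (P.map (X 0)) h x y t = HH (P.map (X 0)) g x y := by
    intro x y
    simp only [h2, h1, Udist, HH, m1, g]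
    ring
  have hHm := HH_meas (P.map (X 0)) hg
  have hw : ∀ i j i' j' : ℕ, Integrable (fun ω =>
      HH (P.map (X 0)) g (X ((i : ℤ) + 1) ω) (X ((j : ℤ) + 1) ω) *
        HH (P.map (X 0)) g (X ((i' : ℤ) + 1) ω) (X ((j' : ℤ) + 1) ω)) P := by
    intro i j i' j'
    refine integrable_bdd (B := (2 * M) * (2 * M))
      ((hHm.comp ((hX _).prodMk (hX _))).mul (hHm.comp ((hX _).prodMk (hX _)))) fun ω => ?_
    rw [abs_mul]
    exact mul_le_mul (HH_abs _ hg g0 gM _ _) (HH_abs _ hg g0 gM _ _) (abs_nonneg _) (by positivity)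
  have hc := comb (e := fun p q r s => |∫ ω, HH (P.map (X 0)) g (X p ω) (X q ω) *
      HH (P.map (X 0)) g (X r ω) (X s ω) ∂P|) hC
    (fun p q r s => by simp only [HH_symm (P.map (X 0)) gs (X p _) (X q _)])
    (fun p q r s => by simp only [mul_comm]) hiso
  have main := Q_as (w := fun i j ω => HH (P.map (X 0)) g (X ((i : ℤ) + 1) ω) (X ((j : ℤ) + 1) ω))
    hw hC hc
  filter_upwards [main] with ω hω
  obtain ⟨K, hK⟩ := hω
  refine ⟨K, hK.mono fun n hn => ?_⟩
  simp only [hh2]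
  rw [sum_reindex (fun i j => HH (P.map (X 0)) g (X i ω) (X j ω)) n]
  exact hn

end UQuantile
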